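/- arXiv:2304.13196 — 5 statements merged into one kernel-verified Lean document; each statement's English description precedes it below -/
import Mathlib

section
/- Let g ≥ 2, let d > 1 be an odd squarefree integer, and let 𝒪 ⊆ π₁Σ_g be the set of d-primitive elements, i.e. elements whose image under the mod-d abelianization π₁Σ_g → (ℤ/d)^{2g} is nonzero. Then there exists a finite-index normal subgroup R of π₁Σ_g whose index divides a power of d and such that H₁^𝒪(R;ℚ) is a proper ℚ-subspace of H₁(R;ℚ) = Abelianization(R) ⊗_ℤ ℚ. -/
open scoped TensorProduct


/-- Images in `H₁(R;ℚ) = ℚ ⊗ Abelianization R` of powers `x^m ∈ R` of elements `x ∈ O`. -/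
def elevationImages {π : Type} [Group π] (R : Subgroup π) (O : Set π) :
    Set (ℚ ⊗[ℤ] Additive (Abelianization ↥R)) :=
  {v | ∃ x ∈ O, ∃ m : ℤ, ∃ h : x ^ m ∈ R,
    v = (1 : ℚ) ⊗ₜ[ℤ] Additive.ofMul (Abelianization.of (⟨x ^ m, h⟩ : ↥R))}

/-- The `O`-homology `H₁^O(R;ℚ)`: the ℚ-span of the images of elevations of elements of `O`. -/
def OHomology {π : Type} [Group π] (R : Subgroup π) (O : Set π) :
    Submodule ℚ (ℚ ⊗[ℤ] Additive (Abelianization ↥R)) :=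
  Submodule.span ℚ (elevationImages R O)

/-- The surface relator `[x₁,y₁]⋯[x_g,y_g]`, with `xᵢ = (i, false)`, `yᵢ = (i, true)`. -/
def surfaceRelator (g : ℕ) : FreeGroup (Fin g × Bool) :=
  (List.ofFn fun i : Fin g =>
    FreeGroup.of (i, false) * FreeGroup.of (i, true) *
      (FreeGroup.of (i, false))⁻¹ * (FreeGroup.of (i, true))⁻¹).prod

/-- The genus-`g` surface group. -/
def SurfaceGroup (g : ℕ) : Type :=
  PresentedGroup {surfaceRelator g}

instance (g : ℕ) : Group (SurfaceGroup g) :=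
  inferInstanceAs (Group (PresentedGroup _))

/-- The standard generators of the surface group. -/
def surfaceGen (g : ℕ) (i : Fin g × Bool) : SurfaceGroup g :=
  PresentedGroup.of i

lemma lift_surfaceRelator {G : Type} [CommGroup G] (g : ℕ) (f : Fin g × Bool → G) :
    FreeGroup.lift f (surfaceRelator g) = 1 := by
  rw [surfaceRelator, map_list_prod]
  refine List.prod_eq_one ?_
  intro x hx
  simp only [List.map_ofFn, List.mem_ofFn, Function.comp] at hx
  obtain ⟨i, rfl⟩ := hx
  simp [mul_comm, mul_assoc, mul_left_comm]

/-- The mod-`d` abelianization of the free group on `m` generators. -/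
def freeModAb (m d : ℕ) : FreeGroup (Fin m) →* Multiplicative (Fin m → ZMod d) :=
  FreeGroup.lift fun i => Multiplicative.ofAdd (Pi.single i (1 : ZMod d))

/-- The mod-`d` abelianization of the genus-`g` surface group. -/
def surfaceModAb (g d : ℕ) : SurfaceGroup g →* Multiplicative (Fin g × Bool → ZMod d) :=
  PresentedGroup.toGroup
    (f := fun i => Multiplicative.ofAdd (Pi.single i (1 : ZMod d)))
    (by intro r hr
        rw [Set.mem_singleton_iff] at hr
        subst hr
        exact lift_surfaceRelator _ _)


/-- The projection from the free group. -/
def surfaceMk (g : ℕ) : FreeGroup (Fin g × Bool) →* SurfaceGroup g :=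
  PresentedGroup.mk {surfaceRelator g}

lemma surfaceMk_surjective (g : ℕ) : Function.Surjective (surfaceMk g) :=
  PresentedGroup.mk_surjective {surfaceRelator g}

section PartA

variable {V : Type} [AddCommGroup V] [Module ℂ V]

/-- The affine permutation attached to a generator. -/
def affPerm {g : ℕ} (ρ : Representation ℂ (SurfaceGroup g) V) (c : Fin g × Bool → V)
    (i : Fin g × Bool) : Equiv.Perm V where
  toFun v := ρ (surfaceGen g i) v + c i
  invFun v := ρ (surfaceGen g i)⁻¹ (v - c i)
  left_inv v := by simp
  right_inv v := by simp

lemma affPerm_free {g : ℕ} (ρ : Representation ℂ (SurfaceGroup g) V)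
    (w : FreeGroup (Fin g × Bool)) :
    ∃ L : (Fin g × Bool → V) →ₗ[ℂ] V, ∀ c v,
      FreeGroup.lift (affPerm ρ c) w v =
        ρ (surfaceMk g w) v + L c := by
  induction w using FreeGroup.induction_on with
  | C1 =>
    refine ⟨0, fun c v => ?_⟩
    have : (surfaceMk g 1) = 1 := map_one _
    rw [this, map_one ρ]; simp
  | of i =>
    refine ⟨LinearMap.proj i, fun c v => ?_⟩
    rw [FreeGroup.lift_apply_of]; rfl
  | inv_of i _ =>
    refine ⟨-((ρ (surfaceGen g i)⁻¹) ∘ₗ LinearMap.proj i), fun c v => ?_⟩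
    have : surfaceMk g (FreeGroup.of i)⁻¹
      = (surfaceGen g i)⁻¹ := map_inv _ _
    rw [this, map_inv, FreeGroup.lift_apply_of]
    change ρ (surfaceGen g i)⁻¹ (v - c i) = _
    simp [sub_eq_add_neg]
  | mul a b ha hb =>
    obtain ⟨La, ha⟩ := ha
    obtain ⟨Lb, hb⟩ := hb
    have : surfaceMk g (a * b)
      = (surfaceMk g a) *
        (surfaceMk g b) := map_mul _ _ _
    refine ⟨(ρ (surfaceMk g a)) ∘ₗ Lb + La,
      fun c v => ?_⟩
    rw [map_mul, Equiv.Perm.mul_apply, hb, ha, this, map_mul ρ]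
    simp [add_assoc]

lemma exists_cocycle [FiniteDimensional ℂ V] [Nontrivial V] {g : ℕ} (hg : 2 ≤ g)
    (ρ : Representation ℂ (SurfaceGroup g) V) :
    ∃ T : SurfaceGroup g →* Equiv.Perm V, (∀ γ v, T γ v = ρ γ v + T γ 0) ∧
      ¬ ∃ v : V, ∀ γ, T γ v = v := by
  obtain ⟨L, hL⟩ := affPerm_free ρ (surfaceRelator g)
  have hr : (surfaceMk g (surfaceRelator g)) = 1 :=
    PresentedGroup.one_of_mem (Set.mem_singleton _)
  rw [hr] at hL
  let B : V →ₗ[ℂ] (Fin g × Bool → V) :=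
    LinearMap.pi fun i => LinearMap.id - ρ (surfaceGen g i)
  have hlt : ¬ LinearMap.ker L ≤ LinearMap.range B := by
    intro h
    have h1 := Submodule.finrank_mono h
    have h2 := LinearMap.finrank_range_le B
    have h3 := LinearMap.finrank_range_add_finrank_ker L
    have h4 := Submodule.finrank_le (LinearMap.range L)
    have h5 : Module.finrank ℂ (Fin g × Bool → V) = (g * 2) * Module.finrank ℂ V := by
      rw [Module.finrank_pi_fintype]; simp
    have h6 : 0 < Module.finrank ℂ V := Module.finrank_pos
    have h7 : 4 * Module.finrank ℂ V ≤ (g * 2) * Module.finrank ℂ V :=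
      Nat.mul_le_mul_right _ (by omega)
    omega
  obtain ⟨c, hc, hcB⟩ := SetLike.not_le_iff_exists.mp hlt
  have hrel : ∀ r ∈ ({surfaceRelator g} : Set (FreeGroup (Fin g × Bool))),
      FreeGroup.lift (affPerm ρ c) r = 1 := by
    intro r hr
    rw [Set.mem_singleton_iff] at hr
    subst hr
    ext v
    rw [hL, LinearMap.mem_ker.mp hc, map_one ρ]
    simp
  let T : SurfaceGroup g →* Equiv.Perm V := PresentedGroup.toGroup hrel
  have hT : ∀ i, T (surfaceGen g i) = affPerm ρ c i := fun i => PresentedGroup.toGroup.of hrel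
  refine ⟨T, ?_, ?_⟩
  · intro γ v
    obtain ⟨w, rfl⟩ := surfaceMk_surjective g γ
    have e : T (surfaceMk g w) = FreeGroup.lift (affPerm ρ c) w := rfl
    obtain ⟨L', hL'⟩ := affPerm_free ρ w
    rw [e, hL' c v, hL' c 0, map_zero, zero_add]
  · rintro ⟨v, hv⟩
    apply hcB
    refine ⟨v, ?_⟩
    ext i
    have := hv (surfaceGen g i)
    rw [hT] at this
    change ρ (surfaceGen g i) v + c i = v at this
    simp only [B, LinearMap.pi_apply, LinearMap.sub_apply, LinearMap.id_apply]
    rw [sub_eq_iff_eq_add, add_comm]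
    exact this.symm

lemma fixed_of_trivial {π : Type} [Group π] (R : Subgroup π) [R.Normal] [R.FiniteIndex]
    (ρ : Representation ℂ π V) (T : π →* Equiv.Perm V)
    (hT : ∀ γ v, T γ v = ρ γ v + T γ 0) (hR : ∀ r ∈ R, ∀ v, T r v = v) :
    ∃ v : V, ∀ γ, T γ v = v := by
  classical
  have : Fintype (π ⧸ R) := Subgroup.fintypeQuotientOfFiniteIndex
  let f : π ⧸ R → V := Quotient.lift (s := QuotientGroup.leftRel R) (fun γ => T γ 0) (by
    intro a b hab
    have : a⁻¹ * b ∈ R := QuotientGroup.leftRel_apply.mp hab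
    have h := hR _ this 0
    have : b = a * (a⁻¹ * b) := by group
    change T a 0 = T b 0
    rw [this, map_mul, Equiv.Perm.mul_apply, h])
  have hf : ∀ γ : π, f (γ : π ⧸ R) = T γ 0 := fun γ => rfl
  have hn : (Fintype.card (π ⧸ R) : ℂ) ≠ 0 := by
    exact_mod_cast Fintype.card_ne_zero
  refine ⟨(Fintype.card (π ⧸ R) : ℂ)⁻¹ • ∑ q, f q, fun γ => ?_⟩
  have key : ∀ q : π ⧸ R, f ((γ : π ⧸ R) * q) = ρ γ (f q) + T γ 0 := by
    intro q
    obtain ⟨b, rfl⟩ := QuotientGroup.mk_surjective q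
    rw [← QuotientGroup.mk_mul, hf, hf, map_mul, Equiv.Perm.mul_apply, hT]
  have hs : ∑ q, f q = ρ γ (∑ q, f q) + (Fintype.card (π ⧸ R) : ℂ) • T γ 0 := by
    conv_lhs => rw [← Equiv.sum_comp (Equiv.mulLeft (γ : π ⧸ R)) f]
    simp only [Equiv.coe_mulLeft, key]
    rw [Finset.sum_add_distrib, map_sum]
    simp [Nat.cast_smul_eq_nsmul]
  rw [hT]
  conv_rhs => rw [hs]
  rw [map_smul, smul_add, smul_smul, inv_mul_cancel₀ hn, one_smul]

lemma homology_of_rep [FiniteDimensional ℂ V] [Nontrivial V] {g : ℕ} (hg : 2 ≤ g)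
    (ρ : Representation ℂ (SurfaceGroup g) V) (R : Subgroup (SurfaceGroup g))
    [R.Normal] [R.FiniteIndex] (hR : ∀ r ∈ R, ρ r = 1) (O : Set (SurfaceGroup g))
    (hO : ∀ x ∈ O, ∀ v, ρ x v = v → v = 0) :
    OHomology R O ≠ ⊤ := by
  obtain ⟨T, hT, hfix⟩ := exists_cocycle hg ρ
  have hex : ∃ r ∈ R, T r 0 ≠ 0 := by
    by_contra! h
    apply hfix
    refine fixed_of_trivial R ρ T hT fun r hr v => ?_
    rw [hT, h r hr, hR r hr]; simp
  obtain ⟨r, hr, hr0⟩ := hex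
  let _ : Module ℚ V := Module.compHom V (algebraMap ℚ ℂ)
  let t : R →* Multiplicative V :=
    { toFun := fun x => Multiplicative.ofAdd (T x 0)
      map_one' := by simp
      map_mul' := by
        intro x y
        rw [← ofAdd_add]
        congr 1
        rw [Subgroup.coe_mul, map_mul, Equiv.Perm.mul_apply, hT, hR x x.2, add_comm]
        simp }
  let t1 : Additive (Abelianization R) →+ V :=
    MonoidHom.toAdditiveLeft (Abelianization.lift t)
  let t2 : ℚ ⊗[ℤ] Additive (Abelianization R) →ₗ[ℚ] V :=
    LinearMap.liftBaseChange ℚ t1.toIntLinearMap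
  have ht2 : ∀ x : R, t2 ((1 : ℚ) ⊗ₜ[ℤ] Additive.ofMul (Abelianization.of x)) = T x 0 := by
    intro x
    simp only [t2, LinearMap.liftBaseChange_tmul, one_smul]
    rfl
  intro htop
  have hle : OHomology R O ≤ LinearMap.ker t2 := by
    refine Submodule.span_le.mpr ?_
    rintro _ ⟨x, hx, m, hm, rfl⟩
    rw [SetLike.mem_coe, LinearMap.mem_ker, ht2]
    apply hO x hx
    have h1 : T (x * x ^ m) 0 = ρ x (T (x ^ m) 0) + T x 0 := by
      rw [map_mul, Equiv.Perm.mul_apply, hT]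
    have h2 : T (x ^ m * x) 0 = T x 0 + T (x ^ m) 0 := by
      rw [map_mul, Equiv.Perm.mul_apply, hT, hR _ hm]; simp
    have h3 : x * x ^ m = x ^ m * x := by group
    rw [h3, h2, add_comm] at h1
    exact (add_right_cancel h1).symm
  rw [htop] at hle
  have := hle (Submodule.mem_top (x := (1 : ℚ) ⊗ₜ[ℤ] Additive.ofMul (Abelianization.of ⟨r, hr⟩)))
  rw [LinearMap.mem_ker, ht2] at this
  exact hr0 this

end PartA

section PartB

/-- The group-theoretic input for the main theorem. -/
def GoodSurface (g d : ℕ) : Prop :=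
  ∃ (R Z : Subgroup (SurfaceGroup g)) (ψ : SurfaceGroup g → ℂ),
    R.Normal ∧ R.FiniteIndex ∧ (∃ k : ℕ, R.index ∣ d ^ k) ∧ R ≤ Z ∧
    (∀ z ∈ Z, ∀ γ, γ * z * γ⁻¹ * z⁻¹ ∈ R) ∧
    (∀ z ∈ Z, ∀ w ∈ Z, ψ (z * w) = ψ z * ψ w) ∧ (∀ r ∈ R, ψ r = 1) ∧
    ∀ γ, surfaceModAb g d γ ≠ 1 → ∃ n : ℕ, γ ^ n ∈ Z ∧ ψ (γ ^ n) ≠ 1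

variable {π : Type} [Group π]

/-- The space of the induced representation. -/
def indSpace (Z : Subgroup π) (ψ : π → ℂ) : Submodule ℂ (π → ℂ) where
  carrier := {f | ∀ z ∈ Z, ∀ γ, f (z * γ) = ψ z * f γ}
  add_mem' := by
    intro a b ha hb z hz γ
    simp only [Pi.add_apply, ha z hz, hb z hz, mul_add]
  zero_mem' := by intro z hz γ; simp
  smul_mem' := by
    intro c f hf z hz γ
    simp only [Pi.smul_apply, hf z hz, smul_eq_mul]; ring

/-- The induced representation. -/
def indRep (Z : Subgroup π) (ψ : π → ℂ) : Representation ℂ π (indSpace Z ψ) where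
  toFun h :=
    { toFun := fun f => ⟨fun γ => f.1 (γ * h), fun z hz γ => by
        change f.1 (z * γ * h) = _
        rw [mul_assoc]; exact f.2 z hz _⟩
      map_add' := fun _ _ => rfl
      map_smul' := fun _ _ => rfl }
  map_one' := by ext f γ; simp
  map_mul' := by intro a b; ext f γ; simp [mul_assoc]

lemma good_homology {g : ℕ} (hg : 2 ≤ g) {d : ℕ} (h : GoodSurface g d) :
    ∃ R : Subgroup (SurfaceGroup g), R.Normal ∧ R.FiniteIndex ∧
      (∃ k : ℕ, R.index ∣ d ^ k) ∧
      OHomology R {x | surfaceModAb g d x ≠ 1} ≠ ⊤ := by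
  classical
  obtain ⟨R, Z, ψ, hRn, hRf, hk, hRZ, hcen, hmul, hR1, hprim⟩ := h
  refine ⟨R, hRn, hRf, hk, ?_⟩
  have hcomm : ∀ z ∈ Z, ∀ f ∈ indSpace Z ψ, ∀ γ, f (γ * z) = ψ z * f γ := by
    intro z hz f hf γ
    have e : γ * z = (γ * z * γ⁻¹ * z⁻¹) * (z * γ) := by group
    rw [e, hf _ (hRZ (hcen z hz γ)), hR1 _ (hcen z hz γ), one_mul, hf z hz]
  have hfin : FiniteDimensional ℂ (indSpace Z ψ) := by
    have : Finite (SurfaceGroup g ⧸ R) := Subgroup.finite_quotient_of_finiteIndex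
    let ev : indSpace Z ψ →ₗ[ℂ] (SurfaceGroup g ⧸ R → ℂ) :=
      { toFun := fun f q => f.1 q.out
        map_add' := fun _ _ => rfl
        map_smul' := fun _ _ => rfl }
    refine Module.Finite.of_injective ev ?_
    intro f f' hff
    ext γ
    have hq := congrFun hff (QuotientGroup.mk γ)
    change f.1 _ = f'.1 _ at hq
    obtain ⟨r, hr⟩ := QuotientGroup.mk_out_eq_mul R γ
    rw [hr, hcomm _ (hRZ r.2) _ f.2, hcomm _ (hRZ r.2) _ f'.2, hR1 _ r.2] at hq
    simpa using hq
  have hnt : Nontrivial (indSpace Z ψ) := by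
    refine ⟨⟨⟨fun γ => if γ ∈ Z then ψ γ else 0, ?_⟩, 0, ?_⟩⟩
    · intro z hz γ
      by_cases hγ : γ ∈ Z
      · simp [hγ, Z.mul_mem hz hγ, hmul z hz γ hγ]
      · have : z * γ ∉ Z := fun h => hγ ((Z.mul_mem_cancel_left hz).mp h)
        simp [hγ, this]
    · intro h
      have := congrFun (congrArg Subtype.val h) 1
      simp [Z.one_mem, hR1 1 R.one_mem] at this
  refine homology_of_rep hg (indRep Z ψ) R ?_ _ ?_
  · intro r hr
    ext f γ
    change f.1 (γ * r) = f.1 γ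
    rw [hcomm r (hRZ hr) f.1 f.2, hR1 r hr, one_mul]
  · intro x hx f hf
    obtain ⟨n, hnZ, hn1⟩ := hprim x hx
    have hpow : ∀ m : ℕ, indRep Z ψ (x ^ m) f = f := by
      intro m
      induction m with
      | zero => simp
      | succ m ih => rw [pow_succ, map_mul, Module.End.mul_apply, hf, ih]
    ext γ
    have h1 : f.1 (γ * x ^ n) = f.1 γ := congrFun (congrArg Subtype.val (hpow n)) γ
    rw [hcomm _ hnZ f.1 f.2] at h1
    have h2 : (ψ (x ^ n) - 1) * f.1 γ = 0 := by linear_combination h1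
    rcases mul_eq_zero.mp h2 with h | h
    · exact absurd (sub_eq_zero.mp h) hn1
    · exact h

/-- The class of an element under reduction of coefficients. -/
lemma surfaceModAb_castHom {g d e : ℕ} (h : d ∣ e) (γ : SurfaceGroup g) (i : Fin g × Bool) :
    Multiplicative.toAdd (surfaceModAb g d γ) i =
      ZMod.castHom h (ZMod d) (Multiplicative.toAdd (surfaceModAb g e γ) i) := by
  obtain ⟨w, rfl⟩ := surfaceMk_surjective g γ
  have H : ∀ d, surfaceModAb g d (surfaceMk g w) =
    FreeGroup.lift (fun i => Multiplicative.ofAdd (Pi.single i (1 : ZMod d))) w := fun _ => rfl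
  rw [H, H]
  clear H
  induction w using FreeGroup.induction_on with
  | C1 => simp
  | of j =>
    simp only [FreeGroup.lift_apply_of, toAdd_ofAdd]
    by_cases hij : i = j
    · subst hij; simp only [Pi.single_eq_same, map_one]
    · simp [hij]
  | inv_of j hj =>
    simp only [map_inv, toAdd_inv, Pi.neg_apply, hj, map_neg]
  | mul a b ha hb =>
    simp only [map_mul, toAdd_mul, Pi.add_apply, ha, hb, map_add]

lemma prim_of_mul {g a b : ℕ} (hab : Nat.Coprime a b) (γ : SurfaceGroup g)
    (h : surfaceModAb g (a * b) γ ≠ 1) : surfaceModAb g a γ ≠ 1 ∨ surfaceModAb g b γ ≠ 1 := by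
  by_contra! hc
  apply h
  apply Multiplicative.toAdd.injective
  ext i
  have h1 := surfaceModAb_castHom (Dvd.intro b rfl : a ∣ a * b) γ i
  have h2 := surfaceModAb_castHom (Dvd.intro_left a rfl : b ∣ a * b) γ i
  rw [hc.1] at h1
  rw [hc.2] at h2
  apply (ZMod.chineseRemainder hab).injective
  rw [toAdd_one, Pi.zero_apply, map_zero]
  ext
  · have e : (RingHom.fst _ _).comp (ZMod.chineseRemainder hab).toRingHom =
        ZMod.castHom (Dvd.intro b rfl : a ∣ a * b) (ZMod a) := Subsingleton.elim _ _
    exact (RingHom.congr_fun e _).trans h1.symm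
  · have e : (RingHom.snd _ _).comp (ZMod.chineseRemainder hab).toRingHom =
        ZMod.castHom (Dvd.intro_left a rfl : b ∣ a * b) (ZMod b) := Subsingleton.elim _ _
    exact (RingHom.congr_fun e _).trans h2.symm

lemma good_aux {g b ka : ℕ} (R1 R2 Z1 Z2 : Subgroup (SurfaceGroup g)) (ψ1 ψ2 : SurfaceGroup g → ℂ)
    {a : ℕ} (hab : Nat.Coprime a b) [R1.Normal] [R2.Normal]
    (h1 : R1.index ∣ a ^ ka) {kb : ℕ} (h2 : R2.index ∣ b ^ kb) (hZ : R2 ≤ Z2)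
    (hmul : ∀ z ∈ Z1, ∀ w ∈ Z1, ψ1 (z * w) = ψ1 z * ψ1 w)
    (hR1 : ∀ r ∈ R1, ψ1 r = 1) (hR2 : ∀ r ∈ R2, ψ2 r = 1) (γ : SurfaceGroup g)
    (n : ℕ) (hn : γ ^ n ∈ Z1) (hn1 : ψ1 (γ ^ n) ≠ 1) :
    ∃ m : ℕ, γ ^ m ∈ Z1 ∧ γ ^ m ∈ Z2 ∧ ψ2 (γ ^ m) = 1 ∧ ψ1 (γ ^ m) ≠ 1 := by
  have hpow : ∀ j : ℕ, ψ1 ((γ ^ n) ^ j) = ψ1 (γ ^ n) ^ j := by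
    intro j
    induction j with
    | zero => simp [hR1 1 R1.one_mem]
    | succ j ih => rw [pow_succ, hmul _ (Z1.pow_mem hn j) _ hn, ih, pow_succ]
  have hmem : (γ ^ n) ^ R2.index ∈ R2 := Subgroup.pow_index_mem R2 _
  refine ⟨n * R2.index, ?_, ?_, ?_, ?_⟩
  · rw [pow_mul]; exact Z1.pow_mem hn _
  · rw [pow_mul]; exact hZ hmem
  · rw [pow_mul]; exact hR2 _ hmem
  · rw [pow_mul, hpow]
    intro h
    have h' : ψ1 (γ ^ n) ^ R1.index = 1 := by
      rw [← hpow]; exact hR1 _ (Subgroup.pow_index_mem R1 _)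
    have hc : Nat.Coprime R1.index R2.index :=
      Nat.Coprime.of_dvd h1 h2 (Nat.Coprime.pow _ _ hab)
    apply hn1
    have := pow_gcd_eq_one.mpr ⟨h', h⟩
    rwa [hc.gcd_eq_one, pow_one] at this

lemma good_mul {g a b : ℕ} (hab : Nat.Coprime a b) (ha : GoodSurface g a)
    (hb : GoodSurface g b) : GoodSurface g (a * b) := by
  obtain ⟨R1, Z1, ψ1, hn1, hf1, ⟨k1, hk1⟩, hRZ1, hc1, hm1, hr1, hp1⟩ := ha
  obtain ⟨R2, Z2, ψ2, hn2, hf2, ⟨k2, hk2⟩, hRZ2, hc2, hm2, hr2, hp2⟩ := hb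
  refine ⟨R1 ⊓ R2, Z1 ⊓ Z2, fun γ => ψ1 γ * ψ2 γ, inferInstance, inferInstance,
    ⟨k1 + k2, ?_⟩, inf_le_inf hRZ1 hRZ2, ?_, ?_, ?_, ?_⟩
  · have hc : Nat.Coprime R1.index R2.index :=
      Nat.Coprime.of_dvd hk1 hk2 (Nat.Coprime.pow _ _ hab)
    have h1 : (R1 ⊓ R2).index ∣ R1.index * R2.index := by
      rw [← Subgroup.relIndex_mul_index (inf_le_right : R1 ⊓ R2 ≤ R2),
        Subgroup.inf_relIndex_right]
      exact Nat.mul_dvd_mul_right (Subgroup.relIndex_dvd_index_of_normal R1 R2) _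
    refine h1.trans ?_
    rw [mul_pow]
    exact Nat.mul_dvd_mul (hk1.trans (pow_dvd_pow _ (by omega)))
      (hk2.trans (pow_dvd_pow _ (by omega)))
  · intro z hz γ
    exact ⟨hc1 z hz.1 γ, hc2 z hz.2 γ⟩
  · intro z hz w hw
    simp only [hm1 z hz.1 w hw.1, hm2 z hz.2 w hw.2]; ring
  · intro r hr
    simp only [hr1 r hr.1, hr2 r hr.2, mul_one]
  · intro γ hγ
    rcases prim_of_mul hab γ hγ with h | h
    · obtain ⟨n, hn, hn'⟩ := hp1 γ h
      obtain ⟨m, h1, h2, h3, h4⟩ := good_aux R1 R2 Z1 Z2 ψ1 ψ2 hab hk1 hk2 hRZ2 hm1 hr1 hr2 γ n hn hn'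
      exact ⟨m, ⟨h1, h2⟩, by simpa only [h3, mul_one] using h4⟩
    · obtain ⟨n, hn, hn'⟩ := hp2 γ h
      obtain ⟨m, h1, h2, h3, h4⟩ :=
        good_aux R2 R1 Z2 Z1 ψ2 ψ1 hab.symm hk2 hk1 hRZ1 hm2 hr2 hr1 γ n hn hn'
      exact ⟨m, ⟨h2, h1⟩, by simpa only [h3, one_mul] using h4⟩

lemma good_of_primes {g : ℕ} (hp : ∀ p : ℕ, p.Prime → Odd p → GoodSurface g p)
    (d : ℕ) (hodd : Odd d) (hsf : Squarefree d) : 1 < d → GoodSurface g d := by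
  induction d using Nat.recOnPosPrimePosCoprime with
  | prime_pow p n hpp hn =>
    intro _
    have : n = 1 := by
      rcases Nat.squarefree_pow_iff hpp.ne_one hn.ne' |>.mp hsf with ⟨_, h⟩
      exact h
    subst this
    rw [pow_one] at hodd ⊢
    exact hp p hpp hodd
  | zero => simp at hsf
  | one => intro h; omega
  | coprime a b ha hb hab iha ihb =>
    intro _
    have h := Nat.odd_mul.mp hodd
    exact good_mul hab (iha h.1 (Squarefree.of_mul_left hsf) ha)
      (ihb h.2 (Squarefree.of_mul_right hsf) hb)

end PartB

section PartC

variable (p : ℕ) [hp : Fact p.Prime]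

lemma frob_mono {x : (AlgebraicClosure (ZMod p))} {k l : ℕ} (hkl : k ≤ l) (h : x ^ p ^ p ^ k = x) :
    x ^ p ^ p ^ l = x := by
  obtain ⟨m, rfl⟩ := Nat.exists_eq_add_of_le hkl
  have : ∀ j : ℕ, x ^ p ^ (p ^ k * j) = x := by
    intro j
    induction j with
    | zero => simp
    | succ j ih => rw [Nat.mul_succ, pow_add, pow_mul, ih, h]
  rw [pow_add p k m]; exact this _

lemma galois_emb (k : ℕ) : ∃ f : GaloisField p (p ^ k) →ₐ[ZMod p] (AlgebraicClosure (ZMod p)),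
    Function.Injective f ∧ ∀ x, (f x) ^ p ^ p ^ k = f x := by
  refine ⟨IsAlgClosed.lift, RingHom.injective _, fun x => ?_⟩
  have hc := GaloisField.card p (p ^ k) (pow_ne_zero _ hp.out.ne_zero)
  have hF : Fintype (GaloisField p (p ^ k)) := Fintype.ofFinite _
  rw [Nat.card_eq_fintype_card] at hc
  rw [← map_pow, ← hc, FiniteField.pow_card]

lemma exists_generic (B : Set (AlgebraicClosure (ZMod p))) (hB : B.Finite) : ∃ (k : ℕ) (z : (AlgebraicClosure (ZMod p))),
    z ∉ B ∧ z ^ p ^ p ^ k = z := by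
  obtain ⟨f, hf, hfr⟩ := galois_emb p B.ncard
  by_contra! hcon
  have hsub : Set.range f ⊆ B := by
    rintro _ ⟨x, rfl⟩
    by_contra hx
    exact hcon _ _ hx (hfr x)
  have h1 := Set.ncard_le_ncard hsub hB
  rw [← Set.image_univ, Set.ncard_image_of_injective _ hf, Set.ncard_univ,
    GaloisField.card p _ (pow_ne_zero _ hp.out.ne_zero)] at h1
  have h2 : B.ncard < p ^ B.ncard := Nat.lt_pow_self hp.out.one_lt
  have h3 : p ^ B.ncard < p ^ p ^ B.ncard := Nat.lt_pow_self hp.out.one_lt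
  omega

/-- The Moore determinant of two elements. -/
def moore {F : Type} [Field F] (p : ℕ) (a b : F) : F := a * b ^ p - a ^ p * b

lemma moore_ne_zero {a b : (AlgebraicClosure (ZMod p))} (h : ∀ v w : ZMod p, v • a + w • b = 0 → v = 0 ∧ w = 0) :
    moore p a b ≠ 0 := by
  intro hm
  have ha : a ≠ 0 := by
    rintro rfl
    have := h 1 0 (by simp)
    exact one_ne_zero this.1
  have h1 : (b / a) ^ p = b / a := by
    unfold moore at hm
    rw [div_pow, div_eq_div_iff (pow_ne_zero _ ha) ha]
    linear_combination hm
  rw [← Subfield.mem_bot_iff_pow_eq_self, ← ZMod.fieldRange_castHom_eq_bot p] at h1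
  obtain ⟨c, hc⟩ := h1
  have hc' : algebraMap (ZMod p) (AlgebraicClosure (ZMod p)) c = b / a := by
    rw [← hc]; exact RingHom.congr_fun (Subsingleton.elim _ _) c
  have := h c (-1) (by
    rw [Algebra.smul_def, hc', neg_smul, one_smul]; field_simp; ring)
  exact one_ne_zero (neg_eq_zero.mp this.2)

/-- An independent family with nonzero symplectic invariant. -/
lemma exists_family_ne (hodd : Odd p) (n : ℕ) (hn : n ≠ 0) : ∃ (k : ℕ) (A B : Fin n → (AlgebraicClosure (ZMod p))),
    (∀ i, A i ^ p ^ p ^ k = A i) ∧ (∀ i, B i ^ p ^ p ^ k = B i) ∧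
    (∀ v w : Fin n → ZMod p, ∑ i, (v i • A i + w i • B i) = 0 → v = 0 ∧ w = 0) ∧
    ∑ i, moore p (A i) (B i) ≠ 0 := by
  classical
  obtain ⟨f, hf, hfr⟩ := galois_emb p (n + n)
  have hdim : Module.finrank (ZMod p) (GaloisField p (p ^ (n + n))) = p ^ (n + n) :=
    GaloisField.finrank p (pow_ne_zero _ hp.out.ne_zero)
  have hlt : n + n ≤ p ^ (n + n) := (Nat.lt_pow_self hp.out.one_lt).le
  let b := Module.finBasisOfFinrankEq (ZMod p) (GaloisField p (p ^ (n + n))) hdim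
  let emb : Fin n ⊕ Fin n → Fin (p ^ (n + n)) := fun j => Fin.castLE hlt (finSumFinEquiv j)
  have hemb : Function.Injective emb :=
    (Fin.castLE_injective hlt).comp finSumFinEquiv.injective
  have hli : LinearIndependent (ZMod p) (fun j => f (b (emb j))) :=
    (b.linearIndependent.comp emb hemb).map' f.toLinearMap (LinearMap.ker_eq_bot.mpr hf)
  rw [Fintype.linearIndependent_iff] at hli
  let A : Fin n → (AlgebraicClosure (ZMod p)) := fun i => f (b (emb (Sum.inl i)))
  let B : Fin n → (AlgebraicClosure (ZMod p)) := fun i => f (b (emb (Sum.inr i)))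
  have hAB : ∀ v w : Fin n → ZMod p, ∑ i, (v i • A i + w i • B i) = 0 → v = 0 ∧ w = 0 := by
    intro v w h
    have := hli (Sum.elim v w) (by
      rw [Fintype.sum_sum_type, ← Finset.sum_add_distrib]; exact h)
    exact ⟨funext fun i => this (Sum.inl i), funext fun i => this (Sum.inr i)⟩
  by_cases ht : ∑ i, moore p (A i) (B i) = 0
  · let i0 : Fin n := ⟨0, Nat.pos_of_ne_zero hn⟩
    let A' : Fin n → (AlgebraicClosure (ZMod p)) := fun i => if i = i0 then B i else A i
    let B' : Fin n → (AlgebraicClosure (ZMod p)) := fun i => if i = i0 then A i else B i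
    refine ⟨n + n, A', B', ?_, ?_, ?_, ?_⟩
    · intro i; by_cases h : i = i0 <;> simp only [A', h, if_true, if_false] <;> exact hfr _
    · intro i; by_cases h : i = i0 <;> simp only [B', h, if_true, if_false] <;> exact hfr _
    · intro v w h
      have h2 := hAB (fun i => if i = i0 then w i else v i) (fun i => if i = i0 then v i else w i)
        (by
          rw [← h]
          refine Finset.sum_congr rfl fun i _ => ?_
          by_cases h : i = i0 <;> simp only [A', B', h, if_true, if_false]
          rw [add_comm])
      constructor
      · funext i
        by_cases h : i = i0
        · simpa [h] using congrFun h2.2 i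
        · simpa [h] using congrFun h2.1 i
      · funext i
        by_cases h : i = i0
        · simpa [h] using congrFun h2.1 i
        · simpa [h] using congrFun h2.2 i
    · intro h0
      have hm : moore p (A i0) (B i0) ≠ 0 := by
        apply moore_ne_zero
        intro v w h
        have := hAB (Pi.single i0 v) (Pi.single i0 w) (by
          rw [Finset.sum_eq_single i0]
          · simpa using h
          · intro j _ hj; simp [hj]
          · simp)
        exact ⟨by simpa using congrFun this.1 i0, by simpa using congrFun this.2 i0⟩
      have hd : ∑ i, moore p (A i) (B i) - ∑ i, moore p (A' i) (B' i)
          = 2 * moore p (A i0) (B i0) := by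
        rw [← Finset.sum_sub_distrib, Finset.sum_eq_single i0]
        · simp only [A', B', if_true, moore]; ring
        · intro j _ hj; simp [A', B', hj]
        · simp
      rw [ht, h0, sub_zero] at hd
      have h2 : (2 : (AlgebraicClosure (ZMod p))) ≠ 0 := by
        have : ((2 : ℕ) : (AlgebraicClosure (ZMod p))) ≠ 0 := by
          rw [Ne, CharP.cast_eq_zero_iff (AlgebraicClosure (ZMod p)) p]
          intro hdiv
          have := (Nat.prime_dvd_prime_iff_eq hp.out Nat.prime_two).mp hdiv
          subst this
          exact absurd hodd (by decide)
        simpa using this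
      exact (mul_ne_zero h2 hm) hd.symm
  · exact ⟨n + n, A, B, fun i => hfr _, fun i => hfr _, hAB, ht⟩

/-- Artin-Schreier roots lie in the tower. -/
lemma artin_schreier {c : (AlgebraicClosure (ZMod p))} {k : ℕ} (hc : c ^ p ^ p ^ k = c) :
    ∃ s : (AlgebraicClosure (ZMod p)), s ^ p - s = c ∧ s ^ p ^ p ^ (k + 1) = s := by
  have hp1 := hp.out.one_lt
  obtain ⟨s, hs⟩ := IsAlgClosed.exists_root (Polynomial.X ^ p - Polynomial.X - Polynomial.C c : Polynomial (AlgebraicClosure (ZMod p))) (by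
    have : (Polynomial.X ^ p - Polynomial.X - Polynomial.C c : Polynomial (AlgebraicClosure (ZMod p))) =
      Polynomial.X ^ p + (- Polynomial.X - Polynomial.C c) := by ring
    rw [this, Polynomial.degree_add_eq_left_of_degree_lt, Polynomial.degree_X_pow]
    · exact_mod_cast hp.out.ne_zero
    · rw [Polynomial.degree_X_pow]
      refine lt_of_le_of_lt (Polynomial.degree_sub_le _ _) (max_lt ?_ ?_)
      · rw [Polynomial.degree_neg, Polynomial.degree_X]; exact_mod_cast hp1
      · exact lt_of_le_of_lt Polynomial.degree_C_le (by exact_mod_cast hp.out.pos))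
  have hs' : s ^ p - s = c := by
    simp [Polynomial.IsRoot] at hs
    linear_combination hs
  refine ⟨s, hs', ?_⟩
  have step : s ^ p = s + c := by linear_combination hs'
  have h1 : ∀ j, s ^ p ^ j = s + ∑ i ∈ Finset.range j, c ^ p ^ i := by
    intro j
    induction j with
    | zero => simp
    | succ j ih =>
      rw [pow_succ', pow_mul, step, add_pow_char_pow, ih, Finset.sum_range_succ, add_assoc]
  set M := p ^ k with hM
  have hT : ∃ T : (AlgebraicClosure (ZMod p)), s ^ p ^ M = s + T ∧ T ^ p ^ M = T := by
    refine ⟨_, h1 M, ?_⟩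
    rw [sum_pow_char_pow]
    refine Finset.sum_congr rfl fun i _ => ?_
    rw [← pow_mul, mul_comm, pow_mul, hc]
  obtain ⟨T, hT1, hT2⟩ := hT
  have h2 : ∀ j : ℕ, s ^ p ^ (M * j) = s + j * T := by
    intro j
    induction j with
    | zero => simp
    | succ j ih =>
      rw [Nat.mul_succ, pow_add, pow_mul, ih, add_pow_char_pow, hT1, mul_pow, hT2]
      have : ((j : (AlgebraicClosure (ZMod p)))) ^ p ^ M = j := by
        have h := ZMod.pow_card_pow (n := M) (j : ZMod p)
        have := congrArg (algebraMap (ZMod p) (AlgebraicClosure (ZMod p))) h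
        rwa [map_pow, map_natCast] at this
      rw [this]; push_cast; ring
  rw [pow_succ, ← hM, h2 p, CharP.cast_eq_zero (AlgebraicClosure (ZMod p)) p]; simp

lemma exists_family (hodd : Odd p) (n : ℕ) (hn : n ≠ 0) :
    ∃ (k : ℕ) (A B : Fin (n + 1) → (AlgebraicClosure (ZMod p))),
    (∀ i, A i ^ p ^ p ^ k = A i) ∧ (∀ i, B i ^ p ^ p ^ k = B i) ∧
    (∀ v w : Fin (n + 1) → ZMod p, ∑ i, (v i • A i + w i • B i) = 0 → v = 0 ∧ w = 0) ∧
    ∑ i, moore p (A i) (B i) = 0 := by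
  classical
  obtain ⟨k, A, B, hA, hB, hAB, ht⟩ := exists_family_ne p hodd n hn
  set t := ∑ i, moore p (A i) (B i) with ht_def
  let φ : (Fin n → ZMod p) × (Fin n → ZMod p) → (AlgebraicClosure (ZMod p)) := fun q => ∑ i, (q.1 i • A i + q.2 i • B i)
  have hφs : ∀ (c : ZMod p) q, φ (c • q) = c • φ q := by
    intro c q
    simp only [φ, Finset.smul_sum, smul_add, Prod.smul_fst, Prod.smul_snd, Pi.smul_apply,
      smul_assoc]
  let bad : Set (AlgebraicClosure (ZMod p)) := ⋃ q, ({φ q} ∪ {a | moore p a (φ q) + t = 0})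
  have hbad : bad.Finite := by
    refine Set.finite_iUnion fun q => (Set.finite_singleton _).union ?_
    let P : Polynomial (AlgebraicClosure (ZMod p)) := Polynomial.C (φ q ^ p) * Polynomial.X
      - Polynomial.C (φ q) * Polynomial.X ^ p + Polynomial.C t
    have hP : P ≠ 0 := by
      intro h
      have := congrArg (Polynomial.eval 0) h
      simp [P, hp.out.ne_zero] at this
      exact ht this
    refine (P.roots.toFinset.finite_toSet).subset ?_
    intro a ha
    have ha' : moore p a (φ q) + t = 0 := ha
    simp only [Finset.mem_coe, Multiset.mem_toFinset, Polynomial.mem_roots hP,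
      Polynomial.IsRoot]
    simp only [P, Polynomial.eval_add, Polynomial.eval_sub, Polynomial.eval_mul,
      Polynomial.eval_C, Polynomial.eval_X, Polynomial.eval_pow]
    rw [← ha', moore]; ring
  obtain ⟨k', a, ha, hak⟩ := exists_generic p bad hbad
  have ha1 : ∀ q, a ≠ φ q := fun q h => ha (Set.mem_iUnion.mpr ⟨q, Or.inl h⟩)
  have ha2 : ∀ q, moore p a (φ q) + t ≠ 0 := fun q h => ha (Set.mem_iUnion.mpr ⟨q, Or.inr h⟩)
  have ha0 : a ≠ 0 := by
    have := ha1 0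
    simpa [φ] using this
  let l := max k k'
  have hA' : ∀ i, A i ^ p ^ p ^ l = A i := fun i => frob_mono p (le_max_left _ _) (hA i)
  have hB' : ∀ i, B i ^ p ^ p ^ l = B i := fun i => frob_mono p (le_max_left _ _) (hB i)
  have hal : a ^ p ^ p ^ l = a := frob_mono p (le_max_right _ _) hak
  have htl : t ^ p ^ p ^ l = t := by
    rw [ht_def, sum_pow_char_pow]
    refine Finset.sum_congr rfl fun i _ => ?_
    rw [moore, sub_pow_char_pow, mul_pow, mul_pow, ← pow_mul, ← pow_mul, mul_comm p, pow_mul,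
      pow_mul, hA', hB']
  obtain ⟨s, hs, hsl⟩ := artin_schreier p (c := (-t / a ^ (p + 1))) (k := l) (by
    rw [div_pow, ← pow_mul, mul_comm (p + 1), pow_mul, hal]
    congr 1
    have : ((-1 : (AlgebraicClosure (ZMod p)))) ^ p ^ p ^ l = -1 := (hodd.pow).neg_one_pow
    rw [neg_eq_neg_one_mul, mul_pow, this, htl])
  have hm : moore p a (a * s) = -t := by
    have : moore p a (a * s) = a ^ (p + 1) * (s ^ p - s) := by rw [moore]; ring
    rw [this, hs]; field_simp
  refine ⟨l + 1, Fin.cons a A, Fin.cons (a * s) B, ?_, ?_, ?_, ?_⟩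
  · intro i
    refine Fin.cases ?_ (fun j => ?_) i
    · exact frob_mono p (Nat.le_succ _) hal
    · exact frob_mono p (Nat.le_succ _) (hA' j)
  · intro i
    refine Fin.cases ?_ (fun j => ?_) i
    · simp only [Fin.cons_zero]
      rw [mul_pow, hsl, frob_mono p (Nat.le_succ _) hal]
    · exact frob_mono p (Nat.le_succ _) (hB' j)
  · intro v w h
    rw [Fin.sum_univ_succ] at h
    simp only [Fin.cons_zero, Fin.cons_succ] at h
    let q : (Fin n → ZMod p) × (Fin n → ZMod p) := (fun i => v i.succ, fun i => w i.succ)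
    have h' : v 0 • a + w 0 • (a * s) + φ q = 0 := h
    have hw : w 0 = 0 := by
      by_contra hw
      apply ha2 ((-(w 0)⁻¹) • q)
      have e : a * s = -((w 0)⁻¹ * v 0) • a + φ ((-(w 0)⁻¹) • q) := by
        rw [hφs]
        have := congrArg (fun x => (w 0)⁻¹ • x) h'
        simp only [smul_add, smul_smul, inv_mul_cancel₀ hw, one_smul, smul_zero] at this
        rw [neg_smul, neg_smul]
        linear_combination this
      have hadd : ∀ (c : ZMod p) (u : (AlgebraicClosure (ZMod p))), moore p a (c • a + u) = moore p a u := by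
        intro c u
        have hc : (algebraMap (ZMod p) (AlgebraicClosure (ZMod p)) c) ^ p = algebraMap (ZMod p) (AlgebraicClosure (ZMod p)) c := by
          rw [← map_pow, ZMod.pow_card]
        rw [moore, moore, add_pow_char, Algebra.smul_def, mul_pow, hc]; ring
      rw [e, hadd] at hm
      rw [hm]; ring
    have hv : v 0 = 0 := by
      by_contra hv
      apply ha1 ((-(v 0)⁻¹) • q)
      rw [hφs]
      have := congrArg (fun x => (v 0)⁻¹ • x) h'
      simp only [hw, zero_smul, add_zero, smul_add, smul_smul, inv_mul_cancel₀ hv, one_smul,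
        smul_zero] at this
      rw [neg_smul]
      linear_combination this
    rw [hv, hw, zero_smul, zero_smul, zero_add, zero_add] at h'
    have := hAB _ _ h'
    constructor
    · funext i
      refine Fin.cases hv (fun j => congrFun this.1 j) i
    · funext i
      refine Fin.cases hw (fun j => congrFun this.2 j) i
  · rw [Fin.sum_univ_succ]
    simp only [Fin.cons_zero, Fin.cons_succ]
    rw [hm, ← ht_def]; ring

end PartC

section PartD

variable {F : Type} [Field F] {m : ℕ}

/-- Matrices supported on the diagonals of index at least `r`. -/
def Lev (m : ℕ) (F : Type) [Field F] (r : ℕ) : AddSubgroup (Matrix (Fin m) (Fin m) F) where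
  carrier := {M | ∀ i j : Fin m, (j : ℕ) < i + r → M i j = 0}
  add_mem' := by intro a b ha hb i j h; simp [ha i j h, hb i j h]
  zero_mem' := by intro i j _; rfl
  neg_mem' := by intro a ha i j h; simp [ha i j h]

lemma lev_mono {r s : ℕ} (h : r ≤ s) {M : Matrix (Fin m) (Fin m) F} (hM : M ∈ Lev m F s) :
    M ∈ Lev m F r := fun i j hij => hM i j (by omega)

lemma lev_mul {r s : ℕ} {M M' : Matrix (Fin m) (Fin m) F} (hM : M ∈ Lev m F r)
    (hM' : M' ∈ Lev m F s) : M * M' ∈ Lev m F (r + s) := by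
  intro i j hij
  rw [Matrix.mul_apply]
  refine Finset.sum_eq_zero fun l _ => ?_
  by_cases h : (l : ℕ) < i + r
  · rw [hM i l h, zero_mul]
  · rw [hM' l j (by omega), mul_zero]

lemma lev_entry {r s : ℕ} {M M' : Matrix (Fin m) (Fin m) F} (hM : M ∈ Lev m F r)
    (hM' : M' ∈ Lev m F s) {i j l : Fin m} (hj : (j : ℕ) = i + r) (hl : (l : ℕ) = j + s) :
    (M * M') i l = M i j * M' j l := by
  rw [Matrix.mul_apply]
  refine Finset.sum_eq_single j (fun q _ hq => ?_) (by simp)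
  by_cases h : (q : ℕ) < i + r
  · rw [hM i q h, zero_mul]
  · have : (q : ℕ) ≠ j := fun h => hq (Fin.ext h)
    rw [hM' q l (by omega), mul_zero]

lemma lev_succ {r : ℕ} {M : Matrix (Fin m) (Fin m) F} (hM : M ∈ Lev m F r)
    (h : ∀ i j : Fin m, (j : ℕ) = i + r → M i j = 0) : M ∈ Lev m F (r + 1) := by
  intro i j hij
  by_cases h' : (j : ℕ) = i + r
  · exact h i j h'
  · exact hM i j (by omega)

lemma lev_top {r : ℕ} (hr : m ≤ r) {M : Matrix (Fin m) (Fin m) F} (hM : M ∈ Lev m F r) :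
    M = 0 := by
  ext i j
  exact hM i j (by omega)

lemma one_lev : (1 : Matrix (Fin m) (Fin m) F) ∈ Lev m F 0 := by
  intro i j hij
  exact Matrix.one_apply_ne (by rintro rfl; omega)

lemma lev_pow {r : ℕ} {M : Matrix (Fin m) (Fin m) F} (hM : M ∈ Lev m F r) (n : ℕ) :
    M ^ n ∈ Lev m F (n * r) := by
  induction n with
  | zero => simpa using one_lev
  | succ n ih => rw [pow_succ, Nat.succ_mul]; exact lev_mul ih hM

lemma lev_pow_entry {M : Matrix (Fin m) (Fin m) F} (hM : M ∈ Lev m F 1) (f : ℕ → F)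
    (hf : ∀ i j : Fin m, (j : ℕ) = i + 1 → M i j = f i) (n : ℕ) :
    ∀ i j : Fin m, (j : ℕ) = i + n → (M ^ n) i j = ∏ q ∈ Finset.range n, f (i + q) := by
  induction n with
  | zero =>
    intro i j h
    have : i = j := Fin.ext (by omega)
    subst this
    simp
  | succ n ih =>
    intro i l h
    have hj : (i : ℕ) + n < m := by omega
    have h1 : M ^ n ∈ Lev m F n := by simpa using lev_pow hM n
    rw [pow_succ, lev_entry h1 hM (j := ⟨i + n, hj⟩) rfl (by simp; omega),
      ih _ _ rfl, hf _ _ (by simp; omega), Finset.prod_range_succ]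

/-- The matrix with superdiagonal `f`, at offset `r`. -/
def offDiag (m : ℕ) (r : ℕ) (f : ℕ → F) : Matrix (Fin m) (Fin m) F :=
  fun i j => if (j : ℕ) = i + r then f i else 0

lemma offDiag_lev (r : ℕ) (f : ℕ → F) : offDiag m r f ∈ Lev m F r := by
  intro i j h
  exact if_neg (by omega)

lemma offDiag_entry (r : ℕ) (f : ℕ → F) {i j : Fin m} (h : (j : ℕ) = i + r) :
    offDiag m r f i j = f i := if_pos h

/-- Conjugating regular unipotents. -/
lemma exists_conj (a b : ℕ → F) (hb : ∀ i, b i ≠ 0) (B' : Matrix (Fin m) (Fin m) F)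
    (hE : B' - offDiag m 1 b ∈ Lev m F 2)
    (h2 : ∀ i j : Fin m, (j : ℕ) = i + 2 → B' i j = a i * b (i + 1) - b i * a (i + 1)) :
    ∃ X : Matrix (Fin m) (Fin m) F, X - 1 ∈ Lev m F 1 ∧
      (∀ i j : Fin m, (j : ℕ) = i + 1 → X i j = a i) ∧ X * offDiag m 1 b = B' * X := by
  set B := offDiag m 1 b with hB
  have hB1 : B ∈ Lev m F 1 := offDiag_lev 1 b
  set E := B' - B with hEdef
  have hB' : B' = B + E := by rw [hEdef]; abel
  have main : ∀ r : ℕ, ∃ X : Matrix (Fin m) (Fin m) F, X - 1 ∈ Lev m F 1 ∧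
      (∀ i j : Fin m, (j : ℕ) = i + 1 → X i j = a i) ∧ X * B - B' * X ∈ Lev m F (r + 3) := by
    intro r
    induction r with
    | zero =>
      have hS := offDiag_lev (m := m) 1 a
      refine ⟨1 + offDiag m 1 a, by simpa using hS, ?_, ?_⟩
      · intro i j h
        rw [Matrix.add_apply, offDiag_entry _ _ h, Matrix.one_apply_ne (by rintro rfl; omega),
          zero_add]
      · have e : (1 + offDiag m 1 a) * B - B' * (1 + offDiag m 1 a) =
          (offDiag m 1 a * B - B * offDiag m 1 a - E) - E * offDiag m 1 a := by
          rw [hB']; noncomm_ring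
        rw [e]
        change _ ∈ Lev m F (2 + 1)
        refine sub_mem (lev_succ (r := 2) (sub_mem (sub_mem (lev_mul (r := 1) (s := 1) hS hB1) (lev_mul (r := 1) (s := 1) hB1 hS)) hE) ?_)
          (lev_mul (r := 2) (s := 1) hE hS)
        intro i l h
        have hj : (i : ℕ) + 1 < m := by omega
        have hl : (l : ℕ) = ((⟨i + 1, hj⟩ : Fin m) : ℕ) + 1 := by simpa using h
        rw [Matrix.sub_apply, Matrix.sub_apply, lev_entry hS hB1 (j := ⟨i + 1, hj⟩) rfl hl,
          lev_entry hB1 hS (j := ⟨i + 1, hj⟩) rfl hl, hEdef, Matrix.sub_apply, h2 i l h,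
          offDiag_entry _ _ rfl, offDiag_entry _ _ hl, hB, offDiag_entry _ _ hl,
          offDiag_entry _ _ rfl]
        have h0 : offDiag m 1 b i l = 0 := if_neg (by omega)
        rw [h0]
        simp only
        ring
    | succ r ih =>
      obtain ⟨X, hX1, hXa, hD⟩ := ih
      set D := X * B - B' * X with hDdef
      let Df : ℕ → F := fun i =>
        if h : i + (r + 3) < m then D ⟨i, by omega⟩ ⟨i + (r + 3), h⟩ else 0
      let v : ℕ → F := fun i =>
        Nat.rec 0 (fun i vi => (vi * b (i + (r + 2)) + Df i) / b i) i
      have hv : ∀ i, v (i + 1) * b i = v i * b (i + (r + 2)) + Df i := fun i =>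
        div_mul_cancel₀ _ (hb i)
      have hV := offDiag_lev (m := m) (r + 2) v
      refine ⟨X + offDiag m (r + 2) v, ?_, ?_, ?_⟩
      · rw [add_sub_right_comm]
        exact add_mem hX1 (lev_mono (by omega) hV)
      · intro i j h
        rw [Matrix.add_apply, hXa i j h, hV i j (by omega), add_zero]
      · have e : (X + offDiag m (r + 2) v) * B - B' * (X + offDiag m (r + 2) v) =
          (D + (offDiag m (r + 2) v * B - B * offDiag m (r + 2) v)) - E * offDiag m (r + 2) v := by
          rw [hDdef, hB']; noncomm_ring
        rw [e]
        change _ ∈ Lev m F ((r + 3) + 1)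
        refine sub_mem (lev_succ (add_mem hD
          (sub_mem (lev_mono (by omega) (lev_mul hV hB1)) ?_)) ?_) ?_
        · exact lev_mono (by omega) (lev_mul hB1 hV)
        · intro i l h
          have hj : (i : ℕ) + 1 < m := by omega
          have hj' : (i : ℕ) + (r + 2) < m := by omega
          rw [Matrix.add_apply, Matrix.sub_apply,
            lev_entry hV hB1 (j := ⟨i + (r + 2), hj'⟩) rfl (by simp; omega),
            lev_entry hB1 hV (j := ⟨i + 1, hj⟩) rfl (by simp; omega),
            offDiag_entry _ _ rfl, hB, offDiag_entry _ _ (by simp; omega),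
            offDiag_entry _ _ rfl, offDiag_entry _ _ (by simp; omega)]
          have hDl : D i l = Df i := by
            have hlt : (i : ℕ) + (r + 3) < m := by omega
            simp only [Df, hlt, dif_pos]
            congr 1
            exact Fin.ext h
          have := hv i
          rw [hDl]
          linear_combination -this
        · exact lev_mono (by omega) (lev_mul hE hV)
  obtain ⟨X, h1, h2', h3⟩ := main m
  exact ⟨X, h1, h2', sub_eq_zero.mp (lev_top (by omega) h3)⟩

/-- Units congruent to `1` modulo `Lev r`. -/
def UU (m : ℕ) (F : Type) [Field F] [Finite F] (r : ℕ) :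
    Subgroup (Matrix (Fin m) (Fin m) F)ˣ where
  carrier := {u | (u : Matrix (Fin m) (Fin m) F) - 1 ∈ Lev m F r}
  one_mem' := by simp [(Lev m F r).zero_mem]
  mul_mem' := by
    intro u v hu hv
    have : ((u * v : (Matrix (Fin m) (Fin m) F)ˣ) : Matrix (Fin m) (Fin m) F) - 1 =
      ((u : Matrix (Fin m) (Fin m) F) - 1) * ((v : Matrix (Fin m) (Fin m) F) - 1) +
      ((u : Matrix (Fin m) (Fin m) F) - 1) + ((v : Matrix (Fin m) (Fin m) F) - 1) := by
      push_cast; noncomm_ring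
    change _ ∈ Lev m F r
    rw [this]
    exact add_mem (add_mem (lev_mono (by omega) (lev_mul hu hv)) hu) hv
  inv_mem' := by
    intro u hu
    have hpow : ∀ n : ℕ, ((u ^ n : (Matrix (Fin m) (Fin m) F)ˣ) : Matrix (Fin m) (Fin m) F) - 1
        ∈ Lev m F r := by
      intro n
      induction n with
      | zero => simp [(Lev m F r).zero_mem]
      | succ n ih =>
        have : ((u ^ (n + 1) : (Matrix (Fin m) (Fin m) F)ˣ) : Matrix (Fin m) (Fin m) F) - 1 =
          (((u ^ n : (Matrix (Fin m) (Fin m) F)ˣ) : Matrix (Fin m) (Fin m) F) - 1) *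
          ((u : Matrix (Fin m) (Fin m) F) - 1) +
          (((u ^ n : (Matrix (Fin m) (Fin m) F)ˣ) : Matrix (Fin m) (Fin m) F) - 1) +
          ((u : Matrix (Fin m) (Fin m) F) - 1) := by
          rw [pow_succ]; push_cast; noncomm_ring
        rw [this]
        exact add_mem (add_mem (lev_mono (by omega) (lev_mul ih hu)) ih) hu
    have hfin : IsOfFinOrder u := isOfFinOrder_of_finite u
    have : u⁻¹ = u ^ (orderOf u - 1) := by
      rw [inv_eq_iff_mul_eq_one, ← pow_succ', Nat.sub_add_cancel hfin.orderOf_pos,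
        pow_orderOf_eq_one]
    change _ ∈ Lev m F r
    rw [this]
    exact hpow _

variable [Finite F]

lemma UU_mul_entry {r : ℕ} (hr : 1 ≤ r) {u v : (Matrix (Fin m) (Fin m) F)ˣ} (hu : u ∈ UU m F r)
    (hv : v ∈ UU m F r) {i j : Fin m} (hij : (j : ℕ) = i + r) :
    ((u * v : (Matrix (Fin m) (Fin m) F)ˣ) : Matrix (Fin m) (Fin m) F) i j =
      (u : Matrix (Fin m) (Fin m) F) i j + (v : Matrix (Fin m) (Fin m) F) i j := by
  have : ((u * v : (Matrix (Fin m) (Fin m) F)ˣ) : Matrix (Fin m) (Fin m) F) =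
      ((u : Matrix (Fin m) (Fin m) F) - 1) * ((v : Matrix (Fin m) (Fin m) F) - 1) +
      (u : Matrix (Fin m) (Fin m) F) + (v : Matrix (Fin m) (Fin m) F) - 1 := by
      push_cast; noncomm_ring
  have h1 : (1 : Matrix (Fin m) (Fin m) F) i j = 0 :=
    Matrix.one_apply_ne (by rintro rfl; omega)
  have h2 := lev_mul hu hv i j (by omega)
  rw [this, Matrix.sub_apply, Matrix.add_apply, Matrix.add_apply, h2, h1]
  ring

lemma UU_inv_entry {r : ℕ} (hr : 1 ≤ r) {u : (Matrix (Fin m) (Fin m) F)ˣ} (hu : u ∈ UU m F r)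
    {i j : Fin m} (hij : (j : ℕ) = i + r) :
    ((u⁻¹ : (Matrix (Fin m) (Fin m) F)ˣ) : Matrix (Fin m) (Fin m) F) i j =
      -(u : Matrix (Fin m) (Fin m) F) i j := by
  have h := UU_mul_entry hr hu (inv_mem hu) hij
  have h1 : (1 : Matrix (Fin m) (Fin m) F) i j = 0 :=
    Matrix.one_apply_ne (by rintro rfl; omega)
  rw [mul_inv_cancel, Units.val_one, h1] at h
  linear_combination -h

lemma exists_unit {X : Matrix (Fin m) (Fin m) F} (hX : X ∈ Lev m F 1) :
    ∃ u ∈ UU m F 1, (u : Matrix (Fin m) (Fin m) F) = 1 + X := by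
  have hnil : IsNilpotent X := ⟨m, lev_top (r := m) le_rfl (by simpa using lev_pow hX m)⟩
  obtain ⟨u, hu⟩ := hnil.isUnit_one_add
  refine ⟨u, ?_, hu⟩
  change (u : Matrix (Fin m) (Fin m) F) - 1 ∈ Lev m F 1
  rw [hu]; simpa using hX

/-- Commutators of elements of `UU 1` are in `UU 2`, with known second diagonal. -/
lemma UU_comm {u v : (Matrix (Fin m) (Fin m) F)ˣ} (hu : u ∈ UU m F 1) (hv : v ∈ UU m F 1) :
    u * v * u⁻¹ * v⁻¹ ∈ UU m F 2 ∧ ∀ i j l : Fin m, (j : ℕ) = i + 1 → (l : ℕ) = j + 1 →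
      ((u * v * u⁻¹ * v⁻¹ : (Matrix (Fin m) (Fin m) F)ˣ) : Matrix (Fin m) (Fin m) F) i l =
      (u : Matrix (Fin m) (Fin m) F) i j * (v : Matrix (Fin m) (Fin m) F) j l -
      (v : Matrix (Fin m) (Fin m) F) i j * (u : Matrix (Fin m) (Fin m) F) j l := by
  set X := (u : Matrix (Fin m) (Fin m) F) - 1 with hX
  set Y := (v : Matrix (Fin m) (Fin m) F) - 1 with hY
  have hX1 : X ∈ Lev m F 1 := hu
  have hY1 : Y ∈ Lev m F 1 := hv
  set W : Matrix (Fin m) (Fin m) F := ((u⁻¹ * v⁻¹ : (Matrix (Fin m) (Fin m) F)ˣ) :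
    Matrix (Fin m) (Fin m) F) - 1 with hW
  have hW1 : W ∈ Lev m F 1 := (UU m F 1).mul_mem (inv_mem hu) (inv_mem hv)
  have hvu : ((v * u * (u⁻¹ * v⁻¹) : (Matrix (Fin m) (Fin m) F)ˣ) : Matrix (Fin m) (Fin m) F)
    = 1 := by
    have : v * u * (u⁻¹ * v⁻¹) = 1 := by group
    rw [this]; rfl
  have hval : ((u * v * u⁻¹ * v⁻¹ : (Matrix (Fin m) (Fin m) F)ˣ) : Matrix (Fin m) (Fin m) F) =
      1 + ((X * Y - Y * X) + (X * Y - Y * X) * W) := by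
    have e : u * v * u⁻¹ * v⁻¹ = u * v * (u⁻¹ * v⁻¹) := by group
    rw [e]
    have : ((u * v * (u⁻¹ * v⁻¹) : (Matrix (Fin m) (Fin m) F)ˣ) : Matrix (Fin m) (Fin m) F) =
      ((v * u * (u⁻¹ * v⁻¹) : (Matrix (Fin m) (Fin m) F)ˣ) : Matrix (Fin m) (Fin m) F) +
      (X * Y - Y * X) * (1 + W) := by
      rw [hW, hX, hY, Units.val_mul (u * v), Units.val_mul (v * u), Units.val_mul u,
        Units.val_mul v]
      noncomm_ring
    rw [this, hvu]; noncomm_ring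
  have hc2 : X * Y - Y * X ∈ Lev m F 2 := sub_mem (lev_mul hX1 hY1) (lev_mul hY1 hX1)
  have hc3 : (X * Y - Y * X) * W ∈ Lev m F 3 := lev_mul hc2 hW1
  constructor
  · change _ - 1 ∈ Lev m F 2
    rw [hval, add_sub_cancel_left]
    exact add_mem hc2 (lev_mono (by omega) hc3)
  · intro i j l hj hl
    have h1 : ∀ i j : Fin m, (j : ℕ) = i + 1 → (1 : Matrix (Fin m) (Fin m) F) i j = 0 :=
      fun i j h => Matrix.one_apply_ne (by rintro rfl; omega)
    have h2 : (1 : Matrix (Fin m) (Fin m) F) i l = 0 :=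
      Matrix.one_apply_ne (by rintro rfl; omega)
    rw [hval, Matrix.add_apply, Matrix.add_apply, h2, hc3 i l (by omega), Matrix.sub_apply,
      lev_entry hX1 hY1 hj hl, lev_entry hY1 hX1 hj hl, hX, hY]
    simp only [Matrix.sub_apply, h1 i j hj, h1 j l hl]
    ring

end PartD

section PartE

lemma exists_finite_family (p : ℕ) [hp : Fact p.Prime] (hodd : Odd p) (n : ℕ) (hn : n ≠ 0) :
    ∃ (F : Type) (_ : Field F) (_ : Finite F) (_ : CharP F p) (k : ℕ) (A B : Fin (n + 1) → F),
      (∀ x : F, x ^ p ^ p ^ k = x) ∧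
      (∀ v w : Fin (n + 1) → ZMod p, ∑ i, (ZMod.castHom (dvd_refl p) F (v i) * A i +
        ZMod.castHom (dvd_refl p) F (w i) * B i) = 0 → v = 0 ∧ w = 0) ∧
      ∑ i, moore p (A i) (B i) = 0 := by
  obtain ⟨k, A, B, hA, hB, hAB, hm⟩ := exists_family p hodd n hn
  let L := AlgebraicClosure (ZMod p)
  let S : Subfield L := RingHom.eqLocusField (iterateFrobenius L p (p ^ k)) (RingHom.id L)
  have hS : ∀ x : L, x ∈ S ↔ x ^ p ^ p ^ k = x := fun x => Iff.rfl
  have h1 : 1 < p ^ p ^ k := Nat.one_lt_pow (pow_ne_zero _ hp.out.ne_zero) hp.out.one_lt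
  have hfin : Finite S := by
    have : ({x : L | x ^ p ^ p ^ k = x}).Finite := by
      refine ((Polynomial.X ^ (p ^ p ^ k) - Polynomial.X : Polynomial L).rootSet_finite L).subset ?_
      intro x hx
      rw [Polynomial.mem_rootSet]
      refine ⟨FiniteField.X_pow_card_sub_X_ne_zero L h1, ?_⟩
      simpa [sub_eq_zero] using hx
    exact this
  refine ⟨S, inferInstance, hfin, inferInstance, k, fun i => ⟨A i, (hS _).2 (hA i)⟩, fun i => ⟨B i, (hS _).2 (hB i)⟩,
    ?_, ?_, ?_⟩
  · intro x
    exact Subtype.ext x.2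
  · intro v w h
    refine hAB v w ?_
    have := congrArg (S.subtype) h
    rw [map_sum, map_zero] at this
    rw [← this]
    refine Finset.sum_congr rfl fun i _ => ?_
    have hc : ∀ c : ZMod p, S.subtype (ZMod.castHom (dvd_refl p) S c) =
        algebraMap (ZMod p) L c := fun c => by
      rw [← RingHom.comp_apply]; exact congrArg (fun f : ZMod p →+* L => f c) (Subsingleton.elim _ _)
    rw [map_add, map_mul, map_mul, hc, hc, Algebra.smul_def, Algebra.smul_def]
    rfl
  · apply S.subtype_injective
    rw [map_sum, map_zero]
    exact hm

end PartE

section PartF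

lemma UU_prod {F : Type} [Field F] [Finite F] {m : ℕ} {r : ℕ} (hr : 1 ≤ r) (n : ℕ)
    (f : Fin n → (Matrix (Fin m) (Fin m) F)ˣ) (hf : ∀ i, f i ∈ UU m F r) :
    (List.ofFn f).prod ∈ UU m F r ∧ ∀ i j : Fin m, (j : ℕ) = i + r →
      ((List.ofFn f).prod : Matrix (Fin m) (Fin m) F) i j =
        ∑ q, (f q : Matrix (Fin m) (Fin m) F) i j := by
  induction n with
  | zero =>
    refine ⟨by simp [one_mem], fun i j h => ?_⟩
    simp only [List.ofFn_zero, List.prod_nil, Units.val_one, Finset.univ_eq_empty,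
      Finset.sum_empty]
    exact Matrix.one_apply_ne (by rintro rfl; omega)
  | succ n ih =>
    obtain ⟨h1, h2⟩ := ih (fun i => f i.succ) (fun i => hf _)
    rw [List.ofFn_succ, List.prod_cons]
    refine ⟨mul_mem (hf 0) h1, fun i j h => ?_⟩
    rw [UU_mul_entry hr (hf 0) h1 h, h2 i j h, Fin.sum_univ_succ]

lemma moore_pow (p : ℕ) [Fact p.Prime] {F : Type} [Field F] [CharP F p] (a b : F) (i : ℕ) :
    moore p a b ^ p ^ i = a ^ p ^ i * b ^ p ^ (i + 1) - b ^ p ^ i * a ^ p ^ (i + 1) := by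
  rw [moore, sub_pow_char_pow, mul_pow, mul_pow, ← pow_mul, ← pow_mul, ← pow_succ']
  ring

lemma exists_gens (p : ℕ) [Fact p.Prime] {F : Type} [Field F] [Finite F] [CharP F p] (n m : ℕ)
    (A B : Fin (n + 1) → F) (hB : B 0 ≠ 0) (hm : ∑ i, moore p (A i) (B i) = 0) :
    ∃ U : Fin (n + 1) × Bool → (Matrix (Fin m) (Fin m) F)ˣ, (∀ t, U t ∈ UU m F 1) ∧
      (∀ t, ∀ i j : Fin m, (j : ℕ) = i + 1 → (U t : Matrix (Fin m) (Fin m) F) i j =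
        (if t.2 then B t.1 else A t.1) ^ p ^ (i : ℕ)) ∧
      FreeGroup.lift U (surfaceRelator (n + 1)) = 1 := by
  have key : ∀ a : F, ∃ u ∈ UU m F 1, (u : Matrix (Fin m) (Fin m) F) =
    1 + offDiag m 1 (fun i => a ^ p ^ i) := fun a => exists_unit (offDiag_lev 1 _)
  choose G hG1 hG using key
  have hGe : ∀ a, ∀ i j : Fin m, (j : ℕ) = i + 1 →
      (G a : Matrix (Fin m) (Fin m) F) i j = a ^ p ^ (i : ℕ) := by
    intro a i j h
    rw [hG, Matrix.add_apply, offDiag_entry _ _ h, Matrix.one_apply_ne (by rintro rfl; omega),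
      zero_add]
  let c : Fin n → (Matrix (Fin m) (Fin m) F)ˣ := fun j =>
    G (A j.succ) * G (B j.succ) * (G (A j.succ))⁻¹ * (G (B j.succ))⁻¹
  obtain ⟨hw2, hwe⟩ := UU_prod (r := 2) (by omega) n c (fun j => (UU_comm (hG1 _) (hG1 _)).1)
  set w := (List.ofFn c).prod with hw
  have hwe' : ∀ i l : Fin m, (l : ℕ) = i + 2 → ((w⁻¹ : (Matrix (Fin m) (Fin m) F)ˣ) :
      Matrix (Fin m) (Fin m) F) i l = moore p (A 0) (B 0) ^ p ^ (i : ℕ) := by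
    intro i l h
    have hj : (i : ℕ) + 1 < m := by omega
    rw [UU_inv_entry (by omega) hw2 h, hwe i l h]
    have : ∀ q, (c q : Matrix (Fin m) (Fin m) F) i l =
        moore p (A q.succ) (B q.succ) ^ p ^ (i : ℕ) := by
      intro q
      have hl : (l : ℕ) = ((⟨i + 1, hj⟩ : Fin m) : ℕ) + 1 := by simp; omega
      rw [(UU_comm (hG1 _) (hG1 _)).2 i ⟨i + 1, hj⟩ l rfl hl, hGe _ _ _ rfl, hGe _ _ _ hl,
        hGe _ _ _ rfl, hGe _ _ _ hl, moore_pow]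
    simp only [this]
    rw [← sum_pow_char_pow]
    rw [Fin.sum_univ_succ] at hm
    have h0 : moore p (A 0) (B 0) = - ∑ q : Fin n, moore p (A q.succ) (B q.succ) := by
      linear_combination hm
    have h1 := congrArg (fun x => x ^ p ^ (i : ℕ)) hm
    rw [add_pow_char_pow, zero_pow (pow_ne_zero _ (Fact.out : p.Prime).ne_zero)] at h1
    linear_combination -h1
  set y := G (B 0) with hy
  set D := offDiag m 1 (fun i => B 0 ^ p ^ i) with hD
  set W : Matrix (Fin m) (Fin m) F := ((w⁻¹ : (Matrix (Fin m) (Fin m) F)ˣ) :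
      Matrix (Fin m) (Fin m) F) - 1 with hW
  have hW2 : W ∈ Lev m F 2 := (UU m F 2).inv_mem hw2
  have hD1 : D ∈ Lev m F 1 := offDiag_lev 1 _
  have hWD := lev_mul hW2 hD1
  have hval : ((w⁻¹ * y : (Matrix (Fin m) (Fin m) F)ˣ) : Matrix (Fin m) (Fin m) F) - 1 =
      D + (W + W * D) := by
    rw [Units.val_mul, hy, hG, hW]; noncomm_ring
  obtain ⟨X, hX1, hXa, hX⟩ := exists_conj (m := m) (fun i => A 0 ^ p ^ i) (fun i => B 0 ^ p ^ i)
    (fun i => pow_ne_zero _ hB) (D + (W + W * D))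
    (by rw [← hD, add_sub_cancel_left]; exact add_mem hW2 (lev_mono (by omega) hWD))
    (by
      intro i l h
      have h0 : D i l = 0 := if_neg (by omega)
      have h1 : (1 : Matrix (Fin m) (Fin m) F) i l = 0 :=
        Matrix.one_apply_ne (by rintro rfl; omega)
      rw [Matrix.add_apply, Matrix.add_apply, h0, hWD i l (by omega), hW, Matrix.sub_apply, h1,
        hwe' i l h, moore_pow]
      ring)
  obtain ⟨x, hx1, hx⟩ := exists_unit hX1
  rw [add_sub_cancel] at hx
  have hxy : x * y = w⁻¹ * y * x := by
    apply Units.ext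
    rw [Units.val_mul, Units.val_mul (w⁻¹ * y), hx, ← sub_add_cancel
      ((w⁻¹ * y : (Matrix (Fin m) (Fin m) F)ˣ) : Matrix (Fin m) (Fin m) F) 1, hval, add_mul,
      ← hX, hy, hG, mul_add, mul_one, one_mul, add_comm]
  let U : Fin (n + 1) × Bool → (Matrix (Fin m) (Fin m) F)ˣ := fun t =>
    if t = (0, false) then x else G (if t.2 then B t.1 else A t.1)
  refine ⟨U, ?_, ?_, ?_⟩
  · intro t
    by_cases h : t = (0, false)
    · simp only [U, h, if_true]; exact hx1
    · simp only [U, h, if_false]; exact hG1 _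
  · intro t i j hij
    by_cases h : t = (0, false)
    · simp only [U, h, if_true, hx]
      simpa using hXa i j hij
    · simp only [U, h, if_false]; exact hGe _ i j hij
  · rw [surfaceRelator, map_list_prod, List.map_ofFn, List.ofFn_succ, List.prod_cons]
    have e1 : U (0, false) = x := if_pos rfl
    have e2 : U (0, true) = y := by simp [U, hy]
    have e3 : ∀ j : Fin n, U (j.succ, false) = G (A j.succ) := fun j => by
      simp [U, Fin.succ_ne_zero]
    have e4 : ∀ j : Fin n, U (j.succ, true) = G (B j.succ) := fun j => by
      simp [U]
    have e5 : (fun i : Fin n => (⇑(FreeGroup.lift U) ∘ fun i : Fin (n + 1) =>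
      FreeGroup.of (i, false) * FreeGroup.of (i, true) *
      (FreeGroup.of (i, false))⁻¹ * (FreeGroup.of (i, true))⁻¹) i.succ) = c := by
      funext j
      simp [c, e3, e4]
    rw [e5, ← hw]
    simp only [Function.comp, map_mul, map_inv, FreeGroup.lift_apply_of, e1, e2]
    rw [hxy]; group

end PartF

section PartG

/-- An additive character that is nontrivial at the nonzero elements of the prime field. -/
lemma exists_char (p : ℕ) [Fact p.Prime] (F : Type) [Field F] [CharP F p] :
    ∃ χ : F → ℂ, (∀ x y, χ (x + y) = χ x * χ y) ∧ χ 0 = 1 ∧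
      ∀ c : ZMod p, c ≠ 0 → χ (ZMod.castHom (dvd_refl p) F c) ≠ 1 := by
  let _ : Algebra (ZMod p) F := ZMod.algebra F p
  obtain ⟨f, hf⟩ := LinearMap.exists_leftInverse_of_injective (Algebra.linearMap (ZMod p) F)
    (LinearMap.ker_eq_bot.2 (algebraMap (ZMod p) F).injective)
  have : NeZero p := ⟨(Fact.out : p.Prime).ne_zero⟩
  refine ⟨fun x => ZMod.stdAddChar (f x), fun x y => ?_, ?_, fun c hc h => hc ?_⟩
  · beta_reduce
    rw [map_add, AddChar.map_add_eq_mul]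
  · beta_reduce
    rw [map_zero, AddChar.map_zero_eq_one]
  · have e : f (ZMod.castHom (dvd_refl p) F c) = c := LinearMap.congr_fun hf c
    beta_reduce at h
    rw [e] at h
    apply ZMod.injective_stdAddChar
    rw [h, AddChar.map_zero_eq_one]

lemma UU_pow_val (p : ℕ) [Fact p.Prime] {F : Type} [Field F] [Finite F] [CharP F p] {m : ℕ}
    (u : (Matrix (Fin (m + 1)) (Fin (m + 1)) F)ˣ) (k : ℕ) :
    ((u ^ p ^ k : (Matrix (Fin (m + 1)) (Fin (m + 1)) F)ˣ) :
      Matrix (Fin (m + 1)) (Fin (m + 1)) F) =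
      1 + ((u : Matrix (Fin (m + 1)) (Fin (m + 1)) F) - 1) ^ p ^ k := by
  have h := add_pow_char_pow_of_commute (p := p) (n := k)
    (Commute.one_left ((u : Matrix (Fin (m + 1)) (Fin (m + 1)) F) - 1))
  rw [one_pow, add_sub_cancel] at h
  rw [Units.val_pow_eq_pow_val, h]

lemma norm_mem_prime (p : ℕ) [hp : Fact p.Prime] {F : Type} [Field F] [CharP F p] (N : ℕ) (x : F)
    (hN : x ^ p ^ N = x) (hx : x ≠ 0) : ∃ c : ZMod p, c ≠ 0 ∧
      ZMod.castHom (dvd_refl p) F c = ∏ i ∈ Finset.range N, x ^ p ^ i := by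
  set ν := ∏ i ∈ Finset.range N, x ^ p ^ i with hν
  have hν0 : ν ≠ 0 := Finset.prod_ne_zero_iff.2 fun i _ => pow_ne_zero _ hx
  have hp' : ν ^ p = ν := by
    have h1 := Finset.prod_range_succ (fun i => x ^ p ^ i) N
    rw [Finset.prod_range_succ', hN, pow_zero, pow_one] at h1
    have h2 := mul_right_cancel₀ hx h1
    rw [hν, ← Finset.prod_pow, ← h2]
    refine Finset.prod_congr rfl fun i _ => ?_
    rw [← pow_mul, ← pow_succ]
  have hmem : ν ∈ (⊥ : Subfield F) := (Subfield.mem_bot_iff_pow_eq_self F p).2 hp'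
  rw [← ZMod.fieldRange_castHom_eq_bot p] at hmem
  obtain ⟨c, hc⟩ := hmem
  refine ⟨c, ?_, hc⟩
  rintro rfl
  exact hν0 (by rw [← hc, map_zero])

lemma good_prime (n : ℕ) (hn : n ≠ 0) (p : ℕ) (hp : p.Prime) (hodd : Odd p) :
    GoodSurface (n + 1) p := by
  have : Fact p.Prime := ⟨hp⟩
  obtain ⟨F, _, _, _, k, A, B, hfix, hinj, hm⟩ := exists_finite_family p hodd n hn
  set N := p ^ k with hNdef
  have hN1 : 1 ≤ N := Nat.one_le_pow _ _ hp.pos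
  have hB0 : B 0 ≠ 0 := by
    intro h0
    have := (hinj 0 (Pi.single 0 1) (by
      rw [Fin.sum_univ_succ]; simp [h0])).2
    have h1 := congrFun this 0
    simp at h1
  obtain ⟨U, hU1, hUe, hUr⟩ := exists_gens p n (N + 1) A B hB0 hm
  obtain ⟨χ, hχm, hχ0, hχ⟩ := exists_char p F
  let φ : SurfaceGroup (n + 1) →* (Matrix (Fin (N + 1)) (Fin (N + 1)) F)ˣ :=
    PresentedGroup.toGroup (f := U) (by
      intro r hr
      rw [Set.mem_singleton_iff] at hr
      subst hr
      exact hUr)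
  let lam : (Fin (n + 1) × Bool → ZMod p) →+ F := AddMonoidHom.mk'
    (fun v => ∑ t, ZMod.castHom (dvd_refl p) F (v t) * (if t.2 then B t.1 else A t.1)) (by
      intro v w
      rw [← Finset.sum_add_distrib]
      refine Finset.sum_congr rfl fun t _ => ?_
      rw [Pi.add_apply, map_add, add_mul])
  have lam_single : ∀ t, lam (Pi.single t 1) = if t.2 then B t.1 else A t.1 := by
    intro t
    change ∑ s, ZMod.castHom (dvd_refl p) F ((Pi.single t 1 : _ → ZMod p) s) * _ = _
    rw [Finset.sum_eq_single t]
    · simp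
    · intro s _ hs
      rw [Pi.single_eq_of_ne hs, map_zero, zero_mul]
    · simp
  have lam_inj : ∀ v, lam v = 0 → v = 0 := by
    intro v hv
    have h1 : ∑ s : Fin (n + 1) × Bool, ZMod.castHom (dvd_refl p) F (v s) *
      (if s.2 then B s.1 else A s.1) = 0 := hv
    rw [Fintype.sum_prod_type] at h1
    have h2 := hinj (fun i => v (i, false)) (fun i => v (i, true)) (by
      rw [← h1]
      refine Finset.sum_congr rfl fun i _ => ?_
      rw [Fintype.sum_bool]
      simp [add_comm])
    funext ⟨i, b⟩
    cases b
    · exact congrFun h2.1 i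
    · exact congrFun h2.2 i
  have hfree : ∀ w : FreeGroup (Fin (n + 1) × Bool), FreeGroup.lift U w ∈ UU (N + 1) F 1 ∧
      ∀ i j : Fin (N + 1), (j : ℕ) = i + 1 →
        (FreeGroup.lift U w : Matrix (Fin (N + 1)) (Fin (N + 1)) F) i j =
        lam (Multiplicative.toAdd (surfaceModAb (n + 1) p (surfaceMk (n + 1) w))) ^ p ^ (i : ℕ) := by
    intro w
    have hof : ∀ t, surfaceModAb (n + 1) p (surfaceMk (n + 1) (FreeGroup.of t)) =
      Multiplicative.ofAdd (Pi.single t (1 : ZMod p)) := fun t => by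
        exact FreeGroup.lift_apply_of
    induction w using FreeGroup.induction_on with
    | C1 =>
      refine ⟨by rw [map_one]; exact one_mem _, fun i j h => ?_⟩
      rw [map_one, map_one, map_one, toAdd_one, map_zero, zero_pow (pow_ne_zero _ hp.ne_zero)]
      exact Matrix.one_apply_ne (by rintro rfl; omega)
    | of t =>
      rw [FreeGroup.lift_apply_of, hof, toAdd_ofAdd, lam_single]
      exact ⟨hU1 t, hUe t⟩
    | inv_of t ih =>
      rw [map_inv, map_inv, map_inv, toAdd_inv, map_neg]
      refine ⟨inv_mem ih.1, fun i j h => ?_⟩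
      rw [UU_inv_entry le_rfl ih.1 h, ih.2 i j h, (hodd.pow).neg_pow]
    | mul x y hx hy =>
      rw [map_mul, map_mul, map_mul, toAdd_mul, map_add]
      refine ⟨mul_mem hx.1 hy.1, fun i j h => ?_⟩
      rw [UU_mul_entry le_rfl hx.1 hy.1 h, hx.2 i j h, hy.2 i j h, add_pow_char_pow]
  have hφ : ∀ γ, φ γ ∈ UU (N + 1) F 1 ∧ ∀ i j : Fin (N + 1), (j : ℕ) = i + 1 →
        (φ γ : Matrix (Fin (N + 1)) (Fin (N + 1)) F) i j =
        lam (Multiplicative.toAdd (surfaceModAb (n + 1) p γ)) ^ p ^ (i : ℕ) := by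
    intro γ
    obtain ⟨w, rfl⟩ := surfaceMk_surjective (n + 1) γ
    exact hfree w
  have hlast : ((Fin.last N : Fin (N + 1)) : ℕ) = ((0 : Fin (N + 1)) : ℕ) + N := by simp
  have h10 : (1 : Matrix (Fin (N + 1)) (Fin (N + 1)) F) 0 (Fin.last N) = 0 :=
    Matrix.one_apply_ne (by
      intro h
      have := congrArg Fin.val h
      rw [hlast] at this
      simp at this; omega)
  refine ⟨φ.ker, (UU (N + 1) F N).comap φ,
    fun γ => χ ((φ γ : Matrix (Fin (N + 1)) (Fin (N + 1)) F) 0 (Fin.last N)),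
    inferInstance, ?_, ?_, ?_, ?_, ?_, ?_, ?_⟩
  · exact Subgroup.finiteIndex_ker φ
  · have hpg : IsPGroup p φ.range := by
      rintro ⟨_, γ, rfl⟩
      refine ⟨N, Subtype.ext ?_⟩
      apply Units.ext
      change (((φ γ) ^ p ^ N : (Matrix (Fin (N + 1)) (Fin (N + 1)) F)ˣ) :
        Matrix (Fin (N + 1)) (Fin (N + 1)) F) = 1
      rw [UU_pow_val]
      have h1 : ((φ γ : Matrix (Fin (N + 1)) (Fin (N + 1)) F) - 1) ^ p ^ N = 0 :=
        lev_top (r := p ^ N * 1) (by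
          have := Nat.lt_pow_self (n := N) hp.one_lt
          omega) (lev_pow (hφ γ).1 _)
      rw [h1, add_zero]
    obtain ⟨e, he⟩ := IsPGroup.iff_card.1 hpg
    exact ⟨e, by rw [Subgroup.index_ker, he]⟩
  · intro γ hγ
    rw [MonoidHom.mem_ker] at hγ
    rw [Subgroup.mem_comap, hγ]
    exact one_mem _
  · intro z hz γ
    rw [MonoidHom.mem_ker, map_mul, map_mul, map_mul, map_inv, map_inv, mul_inv_eq_one,
      mul_inv_eq_iff_eq_mul]
    have hz' : (φ z : Matrix (Fin (N + 1)) (Fin (N + 1)) F) - 1 ∈ Lev (N + 1) F N := hz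
    have hg' : (φ γ : Matrix (Fin (N + 1)) (Fin (N + 1)) F) - 1 ∈ Lev (N + 1) F 1 := (hφ γ).1
    have e1 := lev_top (by omega) (lev_mul hz' hg')
    have e2 := lev_top (by omega) (lev_mul hg' hz')
    apply Units.ext
    rw [Units.val_mul, Units.val_mul]
    have := e2.trans e1.symm
    simp only [mul_sub, sub_mul, one_mul, mul_one] at this
    rw [← sub_eq_zero]
    rw [← sub_eq_zero] at this
    rw [← this]; abel
  · intro z hz w hw
    simp only
    rw [map_mul, UU_mul_entry hN1 hz hw hlast, hχm]
  · intro r hr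
    rw [MonoidHom.mem_ker] at hr
    simp only [hr, Units.val_one, h10, hχ0]
  · intro γ hγ
    have hX1 := (hφ γ).1
    set x := lam (Multiplicative.toAdd (surfaceModAb (n + 1) p γ)) with hxdef
    have hx0 : x ≠ 0 := fun h => hγ (lam_inj _ h)
    obtain ⟨c, hc0, hc⟩ := norm_mem_prime p N x (hfix x) hx0
    have hX : (φ γ : Matrix (Fin (N + 1)) (Fin (N + 1)) F) - 1 ∈ Lev (N + 1) F 1 := hX1
    have hval := UU_pow_val p (φ γ) k
    rw [← hNdef] at hval
    refine ⟨N, ?_, ?_⟩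
    · rw [Subgroup.mem_comap, map_pow]
      change _ - 1 ∈ Lev (N + 1) F N
      rw [hval, add_sub_cancel_left]
      simpa using lev_pow hX N
    · have hent := lev_pow_entry hX (fun i => x ^ p ^ i) (by
        intro i j h
        rw [Matrix.sub_apply, (hφ γ).2 i j h, Matrix.one_apply_ne (by rintro rfl; omega),
          sub_zero]) N 0 (Fin.last N) hlast
      beta_reduce
      rw [map_pow, hval, Matrix.add_apply, h10, hent, zero_add]
      simp only [Fin.val_zero, zero_add]
      rw [← hc]
      exact hχ c hc0

end PartG

/-- Corollary 3.4 (surface case): for odd squarefree d > 1, the d-primitive homology of a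
suitable normal cover whose index divides a power of d is a proper subspace. -/
theorem dprimitive_homology_surface (g : ℕ) (hg : 2 ≤ g)
    (d : ℕ) (hd : 1 < d) (hodd : Odd d) (hsf : Squarefree d) :
    ∃ R : Subgroup (SurfaceGroup g), R.Normal ∧ R.FiniteIndex ∧
      (∃ k : ℕ, R.index ∣ d ^ k) ∧
      OHomology R {x | surfaceModAb g d x ≠ 1} ≠ ⊤ := by
  obtain ⟨n, rfl⟩ : ∃ n, g = n + 1 := ⟨g - 1, by omega⟩
  exact good_homology hg (good_of_primes
    (fun p hp ho => good_prime n (by omega) p hp ho) d hodd hsf hd)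
end

section
/- Let g ≥ 1, let r be a prime, and let R be a finite-index normal subgroup of the surface group π₁Σ_g. Let x ∈ π₁Σ_g be an element whose image under the mod-r abelianization π₁Σ_g → (ℤ/r)^{2g} is nonzero, and let m be the smallest positive integer with x^m ∈ R. Then the image of x^m in Abelianization(R) ⊗_ℤ (ℤ/r) is nonzero. -/
open scoped TensorProduct

section Helpers

/-- Derivations (crossed homomorphisms) into functions on a `S`-set. -/
def IsDer {G S X A : Type} [Group G] [Group S] [MulAction S X] [AddCommGroup A]
    (π : G →* S) (d : G → X → A) : Prop :=
  ∀ f g p, d (f * g) p = d f p + d g ((π f)⁻¹ • p)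

namespace IsDer

variable {G S X A : Type} [Group G] [Group S] [MulAction S X] [AddCommGroup A]
  {π : G →* S} {d e : G → X → A}

lemma one (h : IsDer π d) (p : X) : d 1 p = 0 := by
  have := h 1 1 p
  simpa using this

lemma inv (h : IsDer π d) (f : G) (p : X) : d f⁻¹ p = - d f (π f • p) := by
  have := h f⁻¹ f p
  rw [inv_mul_cancel, h.one] at this
  simp only [map_inv, inv_inv] at this
  exact eq_neg_of_add_eq_zero_left this.symm

/-- elements killed by a derivation -/
def ker (h : IsDer π d) : Subgroup G where
  carrier := {f | ∀ p, d f p = 0}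
  one_mem' := h.one
  mul_mem' := by
    intro a b ha hb p
    rw [h, ha, hb, add_zero]
  inv_mem' := by
    intro a ha p
    rw [h.inv, ha, neg_zero]

lemma comb (h : IsDer π d) (h' : IsDer π e) (n : ℤ) :
    IsDer π (fun f p => d f p + n • e f p) := by
  intro f g p
  simp only [h f g p, h' f g p, smul_add]
  abel

lemma map {B : Type} [AddCommGroup B] (h : IsDer π d) (c : A →+ B) :
    IsDer π (fun f p => c (d f p)) := by
  intro f g p
  simp only [h f g p, map_add]

lemma ext_free {ι : Type} {π : FreeGroup ι →* S} {d e : FreeGroup ι → X → A}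
    (h : IsDer π d) (h' : IsDer π e) (hi : ∀ i p, d (.of i) p = e (.of i) p) :
    ∀ f p, d f p = e f p := by
  intro f
  induction f using FreeGroup.induction_on with
  | C1 => intro p; rw [h.one, h'.one]
  | of i => exact hi i
  | inv_of i _ => intro p; rw [h.inv, h'.inv, hi]
  | mul a b ha hb => intro p; rw [h, h', ha, hb]

end IsDer

lemma exists_der {S X A ι : Type} [Group S] [MulAction S X] [AddCommGroup A]
    (s : ι → S) (u : ι → X → A) :
    ∃ d : FreeGroup ι → X → A, IsDer (FreeGroup.lift s) d ∧ ∀ i p, d (.of i) p = u i p := by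
  let Φ : FreeGroup ι →* SemidirectProduct (X → Multiplicative A) S mulAutArrow :=
    FreeGroup.lift fun i => ⟨fun p => Multiplicative.ofAdd (u i p), s i⟩
  have hr : SemidirectProduct.rightHom.comp Φ = FreeGroup.lift s := by
    ext i
    simp [Φ]
  refine ⟨fun f p => ((Φ f).left p).toAdd, ?_, ?_⟩
  · intro f g p
    rw [← hr]
    simp only [map_mul, SemidirectProduct.mul_left, Pi.mul_apply, toAdd_mul]
    rfl
  · intro i p
    simp [Φ]

abbrev surfComm (g : ℕ) (i : Fin g) : FreeGroup (Fin g × Bool) :=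
  FreeGroup.of (i, false) * FreeGroup.of (i, true) *
      (FreeGroup.of (i, false))⁻¹ * (FreeGroup.of (i, true))⁻¹

lemma surfaceRelator_eq (g : ℕ) :
    surfaceRelator g = ((List.finRange g).map (surfComm g)).prod := by
  rw [surfaceRelator, List.ofFn_eq_map]

/-- the functions that occur as the value at the relator of a derivation -/
def relImage {X S : Type} [Group S] [MulAction S X] (g : ℕ)
    (π : FreeGroup (Fin g × Bool) →* S) : AddSubgroup (X → ℤ) where
  carrier := {w | ∃ d : FreeGroup (Fin g × Bool) → X → ℤ, IsDer π d ∧ d (surfaceRelator g) = w}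
  zero_mem' := ⟨fun _ _ => 0, fun _ _ _ => by simp, rfl⟩
  add_mem' := by
    rintro a b ⟨d, hd, rfl⟩ ⟨e, he, rfl⟩
    refine ⟨_, hd.comb he 1, ?_⟩
    ext p; simp
  neg_mem' := by
    rintro a ⟨d, hd, rfl⟩
    refine ⟨_, (IsDer.comb (d := fun _ _ => 0) (fun _ _ _ => by simp) hd (-1)), ?_⟩
    ext p; simp

/-- elements `h` with `(1-h) M` inside `relImage` -/
def goodSub {X S : Type} [Group S] [MulAction S X] (g : ℕ)
    (π : FreeGroup (Fin g × Bool) →* S) : Subgroup (FreeGroup (Fin g × Bool)) where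
  carrier := {h | ∀ f : X → ℤ, (fun p => f p - f ((π h)⁻¹ • p)) ∈ relImage (X := X) g π}
  one_mem' := by
    intro f
    convert (relImage (X := X) g π).zero_mem using 1
    ext p
    simp
  mul_mem' := by
    intro a b ha hb f
    have h1 := (relImage (X := X) g π).add_mem (ha (fun p => f ((π b)⁻¹ • p))) (hb f)
    convert h1 using 1
    ext p
    simp [mul_smul]
  inv_mem' := by
    intro a ha f
    have h1 := (relImage (X := X) g π).neg_mem (ha (fun p => f ((π a) • p)))
    convert h1 using 1
    ext p
    simp

lemma goodSub_step {X S : Type} [Group S] [MulAction S X] (g : ℕ)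
    (σ : Fin g × Bool → S) (s t : List (Fin g)) (i : Fin g)
    (hst : List.finRange g = s ++ i :: t)
    (hs : (s.map (surfComm g)).prod ∈ goodSub (X := X) g (FreeGroup.lift σ)) :
    FreeGroup.of (i, false) ∈ goodSub (X := X) g (FreeGroup.lift σ) ∧
    FreeGroup.of (i, true) ∈ goodSub (X := X) g (FreeGroup.lift σ) := by
  set π := FreeGroup.lift σ with hπ
  set H := goodSub (X := X) g π
  set P := (s.map (surfComm g)).prod with hP
  set x := FreeGroup.of (i, false) with hx
  set y := FreeGroup.of (i, true) with hy
  have hnd : (s ++ i :: t).Nodup := hst ▸ List.nodup_finRange g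
  have his : i ∉ s := by
    intro h
    exact (List.nodup_append.1 hnd).2.2 i h i (by simp) rfl
  have hit : i ∉ t := (List.nodup_cons.1 (List.nodup_append.1 hnd).2.1).1
  -- derivations supported on the pair `i`
  have key : ∀ d : FreeGroup (Fin g × Bool) → X → ℤ, IsDer π d →
      (∀ j b p, j ≠ i → d (.of (j, b)) p = 0) →
      d (surfaceRelator g) = fun p => d (surfComm g i) ((π P)⁻¹ • p) := by
    intro d hd h0
    have hl : ∀ l : List (Fin g), i ∉ l → (l.map (surfComm g)).prod ∈ hd.ker := by
      intro l hl
      apply Subgroup.list_prod_mem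
      intro z hz
      obtain ⟨j, hj, rfl⟩ := List.mem_map.1 hz
      have hji : j ≠ i := fun h => hl (h ▸ hj)
      have hm : ∀ b, FreeGroup.of (j, b) ∈ hd.ker := fun b p => h0 j b p hji
      exact mul_mem (mul_mem (mul_mem (hm _) (hm _)) (inv_mem (hm _))) (inv_mem (hm _))
    have h1 := hl s his
    have h2 := hl t hit
    ext p
    rw [surfaceRelator_eq, hst, List.map_append, List.prod_append, List.map_cons, List.prod_cons,
      hd, hd, h1 p, h2 _]
    simp [hP]
  have hA : P * (x * y * x⁻¹) * P⁻¹ ∈ H := by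
    intro f
    obtain ⟨d, hd, hdu⟩ := exists_der (X := X) (A := ℤ) σ
      (fun j p => if j = (i, false) then f (π P • p) else 0)
    refine ⟨d, hd, ?_⟩
    rw [key d hd (fun j b p hj => by rw [hdu]; simp [hj])]
    have hx' : ∀ p, d x p = f (π P • p) := fun p => by rw [hx, hdu]; simp
    have hy' : ∀ p, d y p = 0 := fun p => by rw [hy, hdu]; simp
    ext p
    have hd' : IsDer π d := hd
    show d (x * y * x⁻¹ * y⁻¹) _ = _
    simp only [hd' _ _ _, hd'.inv, hx', hy', map_mul, map_inv, mul_inv_rev, inv_inv, mul_smul,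
      smul_inv_smul, inv_smul_smul]
    ring
  have hB : P * (x * y * x⁻¹ * y⁻¹ * x⁻¹) * P⁻¹ ∈ H := by
    intro f
    obtain ⟨d, hd, hdu⟩ := exists_der (X := X) (A := ℤ) σ
      (fun j p => if j = (i, true) then f (π P • π x • p) else 0)
    refine ⟨d, hd, ?_⟩
    rw [key d hd (fun j b p hj => by rw [hdu]; simp [hj])]
    have hy' : ∀ p, d y p = f (π P • π x • p) := fun p => by rw [hy, hdu]; simp
    have hx' : ∀ p, d x p = 0 := fun p => by rw [hx, hdu]; simp
    ext p
    have hd' : IsDer π d := hd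
    show d (x * y * x⁻¹ * y⁻¹) _ = _
    simp only [hd' _ _ _, hd'.inv, hx', hy', map_mul, map_inv, mul_inv_rev, inv_inv, mul_smul,
      smul_inv_smul, inv_smul_smul]
    ring
  have hA' : x * y * x⁻¹ ∈ H := by
    have := mul_mem (mul_mem (inv_mem hs) hA) hs
    convert this using 1; group
  have hB' : x * y * x⁻¹ * y⁻¹ * x⁻¹ ∈ H := by
    have := mul_mem (mul_mem (inv_mem hs) hB) hs
    convert this using 1; group
  have hxy : x * y ∈ H := by
    have := mul_mem (inv_mem hB') hA'
    convert this using 1; group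
  have hxH : x ∈ H := by
    have := mul_mem (inv_mem hA') hxy
    convert this using 1; group
  refine ⟨hxH, ?_⟩
  have := mul_mem (inv_mem hxH) hxy
  convert this using 1; group

lemma goodSub_top {X S : Type} [Group S] [MulAction S X] (g : ℕ)
    (σ : Fin g × Bool → S) : goodSub (X := X) g (FreeGroup.lift σ) = ⊤ := by
  have h : ∀ s t : List (Fin g), List.finRange g = s ++ t → ∀ j ∈ s,
      ∀ b, FreeGroup.of (j, b) ∈ goodSub (X := X) g (FreeGroup.lift σ) := by
    intro s
    induction s using List.reverseRecOn with
    | nil => intro t _ j hj; simp at hj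
    | append_singleton s i ih =>
      intro t ht j hj b
      rw [List.append_assoc, List.singleton_append] at ht
      have ih' := ih _ ht
      rcases List.mem_append.1 hj with hj | hj
      · exact ih' j hj b
      · rw [List.mem_singleton] at hj
        subst hj
        have := goodSub_step (X := X) g σ s t j ht (by
          apply Subgroup.list_prod_mem
          intro z hz
          obtain ⟨k, hk, rfl⟩ := List.mem_map.1 hz
          have hm := ih' k hk
          exact mul_mem (mul_mem (mul_mem (hm _) (hm _)) (inv_mem (hm _))) (inv_mem (hm _)))
        cases b
        · exact this.1
        · exact this.2
  rw [eq_top_iff]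
  intro f _
  induction f using FreeGroup.induction_on with
  | C1 => exact one_mem _
  | of i => exact h (List.finRange g) [] (by simp) i.1 (by simp) i.2
  | inv_of i hi => exact inv_mem (h (List.finRange g) [] (by simp) i.1 (by simp) i.2)
  | mul a b ha hb => exact mul_mem (ha trivial) (hb trivial)

lemma mem_relImage {X S : Type} [Group S] [MulAction S X] [Fintype X] (g : ℕ)
    (σ : Fin g × Bool → S) (p₀ : X)
    (htr : ∀ p : X, ∃ f, (FreeGroup.lift σ f) • p₀ = p) (w : X → ℤ) (hw : ∑ p, w p = 0) :
    w ∈ relImage (X := X) g (FreeGroup.lift σ) := by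
  classical
  choose f hf using htr
  have hgood : ∀ p : X, (fun q => (if q = p₀ then (1:ℤ) else 0) - if q = p then 1 else 0) ∈
      relImage (X := X) g (FreeGroup.lift σ) := by
    intro p
    have h1 : f p ∈ goodSub (X := X) g (FreeGroup.lift σ) := by rw [goodSub_top]; trivial
    have h2 := h1 (fun q => if q = p₀ then 1 else 0)
    convert h2 using 4 with q
    rw [inv_smul_eq_iff, hf]
  have h3 : w = - ∑ p, w p • (fun q => (if q = p₀ then (1:ℤ) else 0) - if q = p then 1 else 0) := by
    ext q
    simp [mul_sub, Finset.sum_sub_distrib, ← Finset.sum_mul, hw]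
  rw [h3]
  exact neg_mem (sum_mem fun p _ => zsmul_mem (hgood p) _)

/-- Homomorphisms from a finite index subgroup of a surface group to `ℤ/m` lift to `ℤ`. -/
lemma lift_hom (g : ℕ) (K : Subgroup (SurfaceGroup g)) [K.FiniteIndex] (m : ℕ)
    (α : K →* Multiplicative (ZMod m)) :
    ∃ β : K →* Multiplicative ℤ, ∀ k, (((β k).toAdd : ℤ) : ZMod m) = (α k).toAdd := by
  classical
  let X := SurfaceGroup g ⧸ K
  haveI : Fintype X := Subgroup.fintypeQuotientOfFiniteIndex
  let p₀ : X := ((1 : SurfaceGroup g) : X)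
  have hsec : ∃ sec : X → SurfaceGroup g, (∀ p, ((sec p : SurfaceGroup g) : X) = p) ∧ sec p₀ = 1 := by
    refine ⟨Function.update Quotient.out p₀ 1, ?_, by simp⟩
    intro p
    by_cases hp : p = p₀
    · subst hp; simp [p₀]
    · simp [hp]
  obtain ⟨sec, hsec, hsec0⟩ := hsec
  have hmem : ∀ (s : SurfaceGroup g) (p : X), (sec p)⁻¹ * s * sec (s⁻¹ • p) ∈ K := by
    intro s p
    rw [mul_assoc, ← QuotientGroup.eq]
    have : ((s * sec (s⁻¹ • p) : SurfaceGroup g) : X) = s • ((sec (s⁻¹ • p) : SurfaceGroup g) : X) := rfl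
    rw [this, hsec, hsec, smul_inv_smul]
  let dα : SurfaceGroup g → X → ZMod m := fun s p => (α ⟨_, hmem s p⟩).toAdd
  have hdα : IsDer (MonoidHom.id (SurfaceGroup g)) dα := by
    intro s t p
    simp only [dα]
    rw [← toAdd_mul, ← map_mul]
    congr 2
    ext
    simp [mul_assoc, mul_smul]
  have hdα0 : ∀ k : K, dα k p₀ = (α k).toAdd := by
    intro k
    simp only [dα]
    congr 2
    ext
    have : (k : SurfaceGroup g)⁻¹ • p₀ = p₀ := by
      show (((k : SurfaceGroup g)⁻¹ * 1 : SurfaceGroup g) : X) = ((1 : SurfaceGroup g) : X)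
      rw [QuotientGroup.eq]
      simp
    simp only [this, hsec0]
    simp
  let σ := surfaceGen g
  let π := FreeGroup.lift σ
  have hπ : ∀ f, π f = (PresentedGroup.mk {surfaceRelator g} f : PresentedGroup {surfaceRelator g}) := by
    intro f
    have : π = (PresentedGroup.mk {surfaceRelator g}) := by
      apply FreeGroup.ext_hom
      intro i
      simp only [π, σ, FreeGroup.lift_apply_of]
      rfl
    rw [this]
    rfl
  have hsurj : Function.Surjective π := by
    intro s
    obtain ⟨f, hf⟩ := PresentedGroup.mk_surjective {surfaceRelator g} s
    exact ⟨f, (hπ f).trans hf⟩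
  have hρ : π (surfaceRelator g) = 1 := by
    rw [hπ]
    exact PresentedGroup.one_of_mem (by simp)
  obtain ⟨d, hd, hdu⟩ := exists_der (X := X) (A := ℤ) σ (fun i p => ((dα (σ i) p).cast : ℤ))
  have hred : ∀ f p, ((d f p : ℤ) : ZMod m) = dα (π f) p := by
    refine IsDer.ext_free (π := π) (hd.map (Int.castAddHom (ZMod m))) (e := fun f p => dα (π f) p) ?_ ?_
    · intro a b p
      simp only [map_mul]
      exact hdα _ _ _
    · intro i p
      simp [hdu, π]
  have hsum : ∑ p, d (surfaceRelator g) p = 0 := by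
    let sumHom : FreeGroup (Fin g × Bool) →* Multiplicative ℤ :=
      MonoidHom.mk' (fun f => Multiplicative.ofAdd (∑ p, d f p)) (by
        intro a b
        rw [← ofAdd_add]
        congr 1
        simp only [hd a b, Finset.sum_add_distrib]
        congr 1
        exact Equiv.sum_comp (MulAction.toPerm ((FreeGroup.lift σ a)⁻¹)) (d b))
    have h1 : sumHom (surfaceRelator g) = 1 := by
      have := lift_surfaceRelator g (fun i => sumHom (.of i))
      rw [← this]
      congr 1
      ext i
      simp
    exact h1
  have hdiv : ∀ p, ∃ w, d (surfaceRelator g) p = m * w := by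
    intro p
    have h1 := hred (surfaceRelator g) p
    rw [hρ, hdα.one] at h1
    exact (ZMod.intCast_zmod_eq_zero_iff_dvd _ _).1 h1
  choose w hw using hdiv
  -- find a correction
  have hcorr : ∃ e : FreeGroup (Fin g × Bool) → X → ℤ, IsDer π e ∧
      ∀ p, d (surfaceRelator g) p = m * e (surfaceRelator g) p := by
    rcases Nat.eq_zero_or_pos m with rfl | hm
    · refine ⟨fun _ _ => 0, fun _ _ _ => by simp, fun p => ?_⟩
      rw [hw]; simp
    · have hw0 : ∑ p, w p = 0 := by
        simp only [hw, ← Finset.mul_sum] at hsum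
        rcases mul_eq_zero.1 hsum with h | h
        · exact absurd h (by exact_mod_cast hm.ne')
        · exact h
      obtain ⟨e, he, hew⟩ := mem_relImage (X := X) g σ p₀ (by
        intro p
        obtain ⟨f, hf⟩ := hsurj (sec p)
        refine ⟨f, ?_⟩
        have hf' : (FreeGroup.lift σ) f = sec p := hf
        rw [hf']
        show ((sec p * 1 : SurfaceGroup g) : X) = p
        rw [mul_one, hsec]) w hw0
      exact ⟨e, he, fun p => by rw [hw, hew]⟩
  obtain ⟨e, he, hde⟩ := hcorr
  have hc : IsDer π _ := IsDer.comb hd he (-(m : ℤ))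
  set c : FreeGroup (Fin g × Bool) → X → ℤ := fun f p => d f p + (-(m : ℤ)) • e f p with hcdef
  have hcρ : ∀ p, c (surfaceRelator g) p = 0 := by
    intro p
    simp [hcdef, hde]
  have hcred : ∀ f p, ((c f p : ℤ) : ZMod m) = dα (π f) p := by
    intro f p
    simp [hcdef, ← hred]
  let N : Subgroup (FreeGroup (Fin g × Bool)) := π.ker ⊓ hc.ker
  haveI : N.Normal := by
    constructor
    rintro n ⟨hn1, hn2⟩ h
    refine ⟨π.normal_ker.conj_mem n hn1 h, ?_⟩
    intro p
    have hn1' : π n = 1 := hn1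
    rw [hc, hc, hc.inv, hn2]
    simp [hn1']
  have hker : ∀ f, π f = 1 → ∀ p, c f p = 0 := by
    intro f hf
    have h1 : Subgroup.normalClosure {surfaceRelator g} ≤ N := by
      apply Subgroup.normalClosure_le_normal
      intro z hz
      rw [Set.mem_singleton_iff] at hz
      subst hz
      exact ⟨hρ, hcρ⟩
    have h2 : f ∈ Subgroup.normalClosure {surfaceRelator g} := by
      rw [hπ] at hf
      exact (QuotientGroup.eq_one_iff f).1 hf
    exact (h1 h2).2
  have hwd : ∀ f f', π f = π f' → c f = c f' := by
    intro f f' hff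
    ext p
    have h1 := hker (f * f'⁻¹) (by simp [hff])
    have h2 := hc (f * f'⁻¹) f' p
    rw [h1] at h2
    simpa [hff] using h2
  choose lft hlft using hsurj
  refine ⟨MonoidHom.mk' (fun k => Multiplicative.ofAdd (c (lft k) p₀)) ?_, ?_⟩
  · intro a b
    rw [← ofAdd_add]
    congr 1
    rw [hwd (lft ↑(a * b)) (lft a * lft b) (by simp [hlft]), hc, hlft]
    congr 2
    show (((a : SurfaceGroup g)⁻¹ * 1 : SurfaceGroup g) : X) = ((1 : SurfaceGroup g) : X)
    rw [QuotientGroup.eq]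
    simp
  · intro k
    rw [← hdα0]
    simp [hcred, hlft]

lemma tensor_ne_zero {R : Type} [Group R] (r : ℕ) (y : R)
    (φ : R →* Multiplicative (ZMod r)) (h : φ y ≠ 1) :
    ((1 : ZMod r) ⊗ₜ[ℤ] Additive.ofMul (Abelianization.of y) :
      ZMod r ⊗[ℤ] Additive (Abelianization R)) ≠ 0 := by
  intro h0
  let ψ : Additive (Abelianization R) →+ ZMod r :=
    MonoidHom.toAdditiveLeft (Abelianization.lift φ)
  let B : ZMod r ⊗[ℤ] Additive (Abelianization R) →ₗ[ℤ] ZMod r :=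
    TensorProduct.lift ((LinearMap.mul ℤ (ZMod r)).compl₂ ψ.toIntLinearMap)
  have h1 : (1 : ZMod r) * ψ (Additive.ofMul (Abelianization.of y)) = 0 :=
    (congrArg B h0).trans (map_zero B)
  rw [one_mul] at h1
  apply h
  have : ψ (Additive.ofMul (Abelianization.of y)) = (φ y).toAdd := by
    simp [ψ]
  have h2 : (φ y).toAdd = 0 := this.symm.trans h1
  exact h2

end Helpers

/-- Lemma (stability of r-nontriviality, surface case): if x is nonzero in H₁(Σ_g; ℤ/r)
and m is minimal positive with x^m ∈ R, then the image of x^m in Abelianization(R) ⊗ ℤ/r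
is nonzero. -/
theorem elevation_nonzero_mod_r_surface (g : ℕ) (hg : 1 ≤ g) (r : ℕ) (hr : r.Prime)
    (R : Subgroup (SurfaceGroup g)) [R.Normal] (hfi : R.FiniteIndex)
    (x : SurfaceGroup g) (hx : surfaceModAb g r x ≠ 1)
    (m : ℕ) (hm : 0 < m) (hxm : x ^ m ∈ R)
    (hmin : ∀ m' : ℕ, 0 < m' → x ^ m' ∈ R → m ≤ m') :
    ((1 : ZMod r) ⊗ₜ[ℤ] Additive.ofMul (Abelianization.of (⟨x ^ m, hxm⟩ : ↥R)) :
      ZMod r ⊗[ℤ] Additive (Abelianization ↥R)) ≠ 0 := by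
  by_cases hrm : r ∣ m
  · -- the subgroup generated by `R` and `x`
    let K : Subgroup (SurfaceGroup g) :=
      (Subgroup.zpowers (QuotientGroup.mk' R x)).comap (QuotientGroup.mk' R)
    have hRK : R ≤ K := by
      intro y hy
      have : QuotientGroup.mk' R y = 1 := (QuotientGroup.eq_one_iff y).2 hy
      show QuotientGroup.mk' R y ∈ Subgroup.zpowers (QuotientGroup.mk' R x)
      rw [this]
      exact one_mem _
    haveI : K.FiniteIndex := Subgroup.finiteIndex_of_le hRK
    have hxK : x ∈ K := Subgroup.mem_zpowers _
    have hord : orderOf (QuotientGroup.mk' R x) = m := by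
      rw [orderOf_eq_iff hm]
      refine ⟨?_, ?_⟩
      · rw [← map_pow]
        exact (QuotientGroup.eq_one_iff _).2 hxm
      · intro k hk hk0 h
        rw [← map_pow] at h
        exact absurd (hmin k hk0 ((QuotientGroup.eq_one_iff _).1 h)) (by omega)
    have hα : ∃ α : K →* Multiplicative (ZMod m), (α ⟨x, hxK⟩).toAdd = 1 ∧
        ∀ y (hy : y ∈ R), (α ⟨y, hRK hy⟩).toAdd = 0 := by
      have hex : ∀ k : K, ∃ n : ℤ, (QuotientGroup.mk' R x) ^ n = QuotientGroup.mk' R k :=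
        fun k => k.2
      choose n hn using hex
      have huniq : ∀ a b : ℤ, (QuotientGroup.mk' R x) ^ a = (QuotientGroup.mk' R x) ^ b →
          (a : ZMod m) = b := by
        intro a b hab
        rw [zpow_eq_zpow_iff_modEq, hord] at hab
        exact (ZMod.intCast_eq_intCast_iff _ _ _).2 hab
      refine ⟨MonoidHom.mk' (fun k => Multiplicative.ofAdd ((n k : ℤ) : ZMod m)) ?_, ?_, ?_⟩
      · intro a b
        rw [← ofAdd_add, ← Int.cast_add]
        congr 1
        apply huniq
        rw [zpow_add, hn, hn, hn, ← map_mul]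
        rfl
      · show ((n ⟨x, hxK⟩ : ℤ) : ZMod m) = 1
        rw [← Int.cast_one]
        apply huniq
        rw [hn, zpow_one]
      · intro y hy
        show ((n ⟨y, hRK hy⟩ : ℤ) : ZMod m) = 0
        rw [← Int.cast_zero]
        apply huniq
        rw [hn, zpow_zero]
        exact (QuotientGroup.eq_one_iff y).2 hy
    obtain ⟨α, hαx, hαR⟩ := hα
    obtain ⟨β, hβ⟩ := lift_hom g K m α
    have hdiv : ∀ y : R, ∃ w : ℤ, (β ⟨y, hRK y.2⟩).toAdd = m * w := by
      intro y
      have h1 := hβ ⟨y, hRK y.2⟩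
      rw [hαR y y.2] at h1
      exact (ZMod.intCast_zmod_eq_zero_iff_dvd _ _).1 h1
    choose w hw using hdiv
    have hm0 : (m : ℤ) ≠ 0 := by exact_mod_cast hm.ne'
    have hwadd : ∀ a b : R, w (a * b) = w a + w b := by
      intro a b
      apply mul_left_cancel₀ hm0
      rw [mul_add, ← hw, ← hw, ← hw, ← toAdd_mul, ← map_mul]
      rfl
    refine tensor_ne_zero r _ (MonoidHom.mk' (fun y => Multiplicative.ofAdd ((w y : ℤ) : ZMod r)) ?_) ?_
    · intro a b
      rw [hwadd, Int.cast_add, ofAdd_add]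
    · intro h
      have h' : ((w ⟨x ^ m, hxm⟩ : ℤ) : ZMod r) = 0 := h
      have hwx : w ⟨x ^ m, hxm⟩ = (β ⟨x, hxK⟩).toAdd := by
        apply mul_left_cancel₀ hm0
        rw [← hw]
        have : (⟨x ^ m, hRK hxm⟩ : K) = ⟨x, hxK⟩ ^ m := rfl
        rw [this, map_pow, toAdd_pow]
        simp
      have h1 := hβ ⟨x, hxK⟩
      rw [hαx, ← hwx, ← Int.cast_one, ZMod.intCast_eq_intCast_iff] at h1
      have h2 := h1.of_dvd (Int.natCast_dvd_natCast.2 hrm)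
      rw [← ZMod.intCast_eq_intCast_iff, h'] at h2
      haveI := Fact.mk hr
      simp at h2
  · have hne : ∃ i, (surfaceModAb g r x).toAdd i ≠ 0 := by
      by_contra! hcon
      exact hx (Multiplicative.toAdd.injective (funext hcon))
    obtain ⟨i, hi⟩ := hne
    let φ : SurfaceGroup g →* Multiplicative (ZMod r) :=
      (AddMonoidHom.toMultiplicative (Pi.evalAddMonoidHom (fun _ => ZMod r) i)).comp (surfaceModAb g r)
    have hφ : (φ x).toAdd ≠ 0 := hi
    refine tensor_ne_zero r _ (φ.comp R.subtype) ?_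
    intro h
    have h1 : (φ (x ^ m)).toAdd = 0 := h
    rw [map_pow, toAdd_pow, nsmul_eq_mul] at h1
    haveI := Fact.mk hr
    rcases mul_eq_zero.1 h1 with h2 | h2
    · exact hrm ((ZMod.natCast_eq_zero_iff _ _).1 h2)
    · exact hφ h2
end

section
/- Let g ≥ 2, let r be an odd prime, and let k be a positive integer with r^k > (2g−1)(r−1). Then there exist a finite group G whose order is a power of r, a subgroup C of G contained in the center of G, and group homomorphisms ρ : π₁Σ_g → G, α : G → (ℤ/r)^{2g}, and Ψ : C → ℤ/r such that: (1) the composition α ∘ ρ equals the mod-r abelianization π₁Σ_g → (ℤ/r)^{2g}; and (2) for every g ∈ G with α(g) ≠ 0, the element g^{r^k} lies in C and Ψ(g^{r^k}) ≠ 0. -/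
def SurfReal (g r N : ℕ) (f : (Fin g × Bool → ZMod r) → ZMod r) : Prop :=
  ∃ (G : Type) (_ : Group G) (_ : Finite G), IsPGroup r G ∧
    ∃ (C : Subgroup G) (ρ : SurfaceGroup g →* G)
      (α : G →* Multiplicative (Fin g × Bool → ZMod r))
      (Ψ : ↥C →* Multiplicative (ZMod r)),
      C ≤ Subgroup.center G ∧ α.comp ρ = surfaceModAb g r ∧
      ∀ x : G, ∃ h : x ^ N ∈ C,
        Ψ ⟨x ^ N, h⟩ = Multiplicative.ofAdd (f (Multiplicative.toAdd (α x)))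

lemma SurfReal.smul {g r N : ℕ} {f : (Fin g × Bool → ZMod r) → ZMod r}
    (hf : SurfReal g r N f) (c : ZMod r) : SurfReal g r N (fun v => c * f v) := by
  obtain ⟨G, i1, i2, hp, C, ρ, α, Ψ, hC, hα, h⟩ := hf
  refine ⟨G, i1, i2, hp, C, ρ, α,
    (AddMonoidHom.toMultiplicative (AddMonoidHom.mulLeft c)).comp Ψ, hC, hα, fun x => ?_⟩
  obtain ⟨hx, hx2⟩ := h x
  refine ⟨hx, ?_⟩
  rw [MonoidHom.comp_apply, hx2]
  rfl

lemma SurfReal.add {g r N : ℕ} {f f' : (Fin g × Bool → ZMod r) → ZMod r}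
    (hf : SurfReal g r N f) (hf' : SurfReal g r N f') :
    SurfReal g r N (fun v => f v + f' v) := by
  obtain ⟨G, i1, i2, hp, C, ρ, α, Ψ, hC, hα, h⟩ := hf
  obtain ⟨G', i1', i2', hp', C', ρ', α', Ψ', hC', hα', h'⟩ := hf'
  let H : Subgroup (G × G') :=
    (α.comp (MonoidHom.fst G G')).eqLocus (α'.comp (MonoidHom.snd G G'))
  let p1 : H →* G := (MonoidHom.fst G G').comp H.subtype
  let p2 : H →* G' := (MonoidHom.snd G G').comp H.subtype
  let D : Subgroup H := (C.comap p1) ⊓ (C'.comap p2)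
  let q1 : D →* C := (p1.comp D.subtype).codRestrict C (fun x => x.2.1)
  let q2 : D →* C' := (p2.comp D.subtype).codRestrict C' (fun x => x.2.2)
  refine ⟨H, inferInstance, inferInstance, ?_, D, ?_, α.comp p1, (Ψ.comp q1) * (Ψ'.comp q2), ?_, ?_, ?_⟩
  · intro x
    obtain ⟨a, ha⟩ := hp x.1.1
    obtain ⟨b, hb⟩ := hp' x.1.2
    refine ⟨a + b, ?_⟩
    apply Subtype.ext
    apply Prod.ext
    · show x.1.1 ^ r ^ (a + b) = 1
      rw [pow_add, pow_mul, ha, one_pow]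
    · show x.1.2 ^ r ^ (a + b) = 1
      rw [add_comm, pow_add, pow_mul, hb, one_pow]
  · refine (ρ.prod ρ').codRestrict H (fun x => ?_)
    show (α.comp ρ) x = (α'.comp ρ') x
    rw [hα, hα']
  · intro x hx
    rw [Subgroup.mem_center_iff]
    intro y
    apply Subtype.ext
    apply Prod.ext
    · exact Subgroup.mem_center_iff.1 (hC hx.1) y.1.1
    · exact Subgroup.mem_center_iff.1 (hC' hx.2) y.1.2
  · exact Eq.trans rfl hα
  · intro x
    obtain ⟨h1, h2⟩ := h x.1.1
    obtain ⟨h1', h2'⟩ := h' x.1.2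
    refine ⟨⟨h1, h1'⟩, ?_⟩
    have hx : α x.1.1 = α' x.1.2 := x.2
    have e : ((Ψ.comp q1) * (Ψ'.comp q2)) ⟨x ^ N, ⟨h1, h1'⟩⟩
      = Ψ ⟨x.1.1 ^ N, h1⟩ * Ψ' ⟨x.1.2 ^ N, h1'⟩ := rfl
    rw [e, h2, h2', ← hx, ← ofAdd_add]
    rfl

/-- filtration of matrices -/
def MFilt {R : Type} [CommRing R] {N : ℕ} (m : ℕ) (A : Matrix (Fin (N+1)) (Fin (N+1)) R) : Prop :=
  ∀ a b : Fin (N+1), b.val < a.val + m → A a b = 0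

lemma MFilt.mul {R : Type} [CommRing R] {N : ℕ} {m m' : ℕ}
    {A B : Matrix (Fin (N+1)) (Fin (N+1)) R} (hA : MFilt m A) (hB : MFilt m' B) :
    MFilt (m + m') (A * B) := by
  intro a b hab
  rw [Matrix.mul_apply]
  refine Finset.sum_eq_zero fun c _ => ?_
  by_cases h : c.val < a.val + m
  · rw [hA a c h, zero_mul]
  · rw [hB c b (by omega), mul_zero]

lemma MFilt.pow {R : Type} [CommRing R] {N : ℕ}
    {A : Matrix (Fin (N+1)) (Fin (N+1)) R} (hA : MFilt 1 A) (m : ℕ) :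
    MFilt m (A ^ m) := by
  induction m with
  | zero =>
    intro a b hab
    rw [pow_zero, Matrix.one_apply_ne]
    rintro rfl
    omega
  | succ m ih => rw [pow_succ]; exact ih.mul hA

lemma MFilt.eq_zero {R : Type} [CommRing R] {N : ℕ} {m : ℕ} (hm : N < m)
    {A : Matrix (Fin (N+1)) (Fin (N+1)) R} (hA : MFilt m A) : A = 0 := by
  ext a b
  exact hA a b (by omega)

lemma MFilt.pow_apply {R : Type} [CommRing R] {N : ℕ}
    {A : Matrix (Fin (N+1)) (Fin (N+1)) R} (hA : MFilt 1 A) (L : ℕ → R)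
    (hL : ∀ a b : Fin (N+1), b.val = a.val + 1 → A a b = L a.val) (m : ℕ)
    (a b : Fin (N+1)) (hab : b.val = a.val + m) :
    (A ^ m) a b = ∏ p ∈ Finset.range m, L (a.val + p) := by
  induction m generalizing b with
  | zero =>
    have : b = a := Fin.ext (by omega)
    subst this
    simp
  | succ m ih =>
    rw [pow_succ, Matrix.mul_apply, Finset.prod_range_succ]
    have hlt : a.val + m < N + 1 := by omega
    rw [Finset.sum_eq_single (⟨a.val + m, hlt⟩ : Fin (N+1))]
    · rw [ih _ rfl, hL _ _ (by simp; omega)]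
    · intro c _ hc
      have hc' : c.val ≠ a.val + m := fun h => hc (Fin.ext h)
      by_cases h : c.val < a.val + m
      · rw [hA.pow m a c h, zero_mul]
      · rw [hA c b (by omega), mul_zero]
    · simp

/-- the linear form attached to position p -/
def wform {g r : ℕ} (l : ℕ → Fin g × Bool → ZMod r) (v : Fin g × Bool → ZMod r) (p : ℕ) : ZMod r :=
  ∑ i, l p i * v i

/-- The monoid of unitriangular matrices with prescribed superdiagonal. -/
def wMonoid {g r : ℕ} (N : ℕ) (l : ℕ → Fin g × Bool → ZMod r) :
    Submonoid (Multiplicative (Fin g × Bool → ZMod r) ×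
      Matrix (Fin (N+1)) (Fin (N+1)) (ZMod r)) where
  carrier := {t | MFilt 1 (t.2 - 1) ∧
    ∀ a b : Fin (N+1), b.val = a.val + 1 →
      (t.2 - 1) a b = wform l (Multiplicative.toAdd t.1) a.val}
  one_mem' := by
    refine ⟨fun a b _ => by simp, fun a b _ => by simp [wform]⟩
  mul_mem' := by
    rintro ⟨v, A⟩ ⟨w, B⟩ ⟨hA, hA'⟩ ⟨hB, hB'⟩
    dsimp only at hA hA' hB hB'
    have e : A * B - 1 = (A - 1) + (B - 1) + (A - 1) * (B - 1) := by noncomm_ring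
    constructor
    · intro a b hab
      show (A * B - 1) a b = 0
      rw [e, Matrix.add_apply, Matrix.add_apply, hA a b hab, hB a b hab,
        hA.mul hB a b (by omega)]
      simp
    · intro a b hab
      show (A * B - 1) a b = _
      rw [e, Matrix.add_apply, Matrix.add_apply, hA' a b hab, hB' a b hab,
        hA.mul hB a b (by omega)]
      simp [wform, mul_add, Finset.sum_add_distrib]

lemma wMonoid_pow {g r k : ℕ} (hr : r.Prime) (l : ℕ → Fin g × Bool → ZMod r)
    (t : wMonoid (r ^ k) l) (m : ℕ) :
    (t.1.2) ^ (r ^ m) = 1 + (t.1.2 - 1) ^ (r ^ m) := by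
  have := Fact.mk hr
  have := add_pow_char_pow_of_commute r m
    (Commute.one_left (t.1.2 - 1))
  rw [one_pow] at this
  rw [← this]
  congr 1
  abel

lemma wMonoid_tors {g r k : ℕ} (hr : r.Prime) (l : ℕ → Fin g × Bool → ZMod r)
    (t : wMonoid (r ^ k) l) : t ^ (r ^ (k + 1)) = 1 := by
  apply Subtype.ext
  apply Prod.ext
  · show t.1.1 ^ (r ^ (k+1)) = 1
    apply Multiplicative.toAdd.injective
    rw [toAdd_pow, toAdd_one]
    ext i
    simp [pow_succ]
  · show t.1.2 ^ (r ^ (k+1)) = 1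
    rw [wMonoid_pow hr, (t.2.1.pow (r ^ (k+1))).eq_zero (Nat.pow_lt_pow_right hr.one_lt (by omega)),
      add_zero]

@[reducible]
def wGroup {g r k : ℕ} (hr : r.Prime) (l : ℕ → Fin g × Bool → ZMod r) :
    Group (wMonoid (r ^ k) l) :=
  { (inferInstance : Monoid (wMonoid (r ^ k) l)) with
    inv := fun t => t ^ (r ^ (k + 1) - 1)
    inv_mul_cancel := fun t => by
      show t ^ (r ^ (k + 1) - 1) * t = 1
      rw [← pow_succ, Nat.sub_add_cancel (Nat.pow_pos hr.pos), wMonoid_tors hr] }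

lemma ofFn_comm_prod {H : Type} [Group H] {R : Type} [AddCommGroup R] {g : ℕ}
    (Z : Multiplicative R →* H) (X : Fin g × Bool → H) (d : Fin g → R)
    (h : ∀ c, X (c, false) * X (c, true) = Z (Multiplicative.ofAdd (d c)) * (X (c, true) * X (c, false)))
    (hd : ∑ c, d c = 0) : FreeGroup.lift X (surfaceRelator g) = 1 := by
  rw [surfaceRelator, map_list_prod, List.map_ofFn]
  have : (⇑(FreeGroup.lift X) ∘ fun i : Fin g => FreeGroup.of (i, false) * FreeGroup.of (i, true) *
      (FreeGroup.of (i, false))⁻¹ * (FreeGroup.of (i, true))⁻¹) =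
      ⇑Z ∘ fun c => Multiplicative.ofAdd (d c) := by
    funext c
    simp only [Function.comp_apply, map_mul, map_inv, FreeGroup.lift_apply_of, h c]
    group
  rw [this, ← List.map_ofFn, ← map_list_prod, List.prod_ofFn, ← ofAdd_sum, hd]
  simp

/-- the generator nilpotent -/
def wNil {g r : ℕ} (N : ℕ) (l : ℕ → Fin g × Bool → ZMod r) (i : Fin g × Bool) :
    Matrix (Fin (N+1)) (Fin (N+1)) (ZMod r) :=
  Matrix.of fun a b => if b.val = a.val + 1 then l a.val i else 0

lemma wNil_mul {g r : ℕ} (N : ℕ) (l : ℕ → Fin g × Bool → ZMod r) (i j : Fin g × Bool)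
    (a b : Fin (N+1)) :
    (wNil N l i * wNil N l j) a b =
      if b.val = a.val + 2 then l a.val i * l (a.val + 1) j else 0 := by
  rw [Matrix.mul_apply]
  split_ifs with h
  · rw [Finset.sum_eq_single (⟨a.val + 1, by omega⟩ : Fin (N+1))]
    · simp [wNil, h]
    · intro c _ hc
      have hc' : c.val ≠ a.val + 1 := fun h => hc (Fin.ext h)
      simp [wNil, hc']
    · simp
  · refine Finset.sum_eq_zero fun c _ => ?_
    by_cases h1 : c.val = a.val + 1
    · have : b.val ≠ c.val + 1 := by omega
      simp [wNil, this]
    · simp [wNil, h1]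

def wGen {g r : ℕ} (N : ℕ) (l : ℕ → Fin g × Bool → ZMod r) (i : Fin g × Bool) :
    wMonoid N l :=
  ⟨(Multiplicative.ofAdd (Pi.single i 1), 1 + wNil N l i), by
    constructor
    · intro a b hab
      have : b.val ≠ a.val + 1 := by omega
      simp [wNil, this]
    · intro a b hab
      simp [wNil, hab, wform, Pi.single_apply]⟩

def wIdx (N : ℕ) : Fin (N+1) := ⟨N - 2, by omega⟩

lemma wIdx_val (N : ℕ) : (wIdx N).val = N - 2 := rfl

def wZ {g r : ℕ} (N : ℕ) (hN : 3 ≤ N) (l : ℕ → Fin g × Bool → ZMod r) :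
    Multiplicative (ZMod r) →* wMonoid N l where
  toFun d := ⟨(1, 1 + Matrix.single (wIdx N) (Fin.last N) (Multiplicative.toAdd d)), by
    constructor
    · intro a b hab
      simp only [add_sub_cancel_left]
      rw [Matrix.single_apply_of_ne]
      rintro ⟨rfl, rfl⟩
      simp [wIdx_val] at hab
      omega
    · intro a b hab
      simp only [add_sub_cancel_left]
      rw [Matrix.single_apply_of_ne]
      · simp [wform]
      · rintro ⟨rfl, rfl⟩
        simp [wIdx_val] at hab
        omega⟩
  map_one' := by
    apply Subtype.ext
    simp
  map_mul' d e := by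
    apply Subtype.ext
    apply Prod.ext
    · simp
    · simp only [toAdd_mul, Matrix.single_add, Submonoid.coe_mul, Prod.snd_mul]
      rw [mul_add, add_mul, add_mul, Matrix.single_mul_single_of_ne]
      · simp [add_assoc]
      · intro h
        have := congrArg Fin.val h
        simp [wIdx_val] at this
        omega

lemma wGen_comm {g r : ℕ} (N : ℕ) (hN : 3 ≤ N) (l : ℕ → Fin g × Bool → ZMod r)
    (x y : Fin g × Bool) (h : ∀ p, p + 2 < N → l p x * l (p + 1) y = l p y * l (p + 1) x) :
    wGen N l x * wGen N l y =
      wZ N hN l (Multiplicative.ofAdd (l (N - 2) x * l (N - 1) y - l (N - 2) y * l (N - 1) x))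
        * (wGen N l y * wGen N l x) := by
  apply Subtype.ext
  apply Prod.ext
  · show (wGen N l x).1.1 * (wGen N l y).1.1 = 1 * ((wGen N l y).1.1 * (wGen N l x).1.1)
    rw [one_mul, mul_comm]
  · set d := l (N - 2) x * l (N - 1) y - l (N - 2) y * l (N - 1) x with hd
    set z : Matrix (Fin (N+1)) (Fin (N+1)) (ZMod r) :=
      Matrix.single (wIdx N) (Fin.last N) d with hz
    show (1 + wNil N l x) * (1 + wNil N l y) = (1 + z) * ((1 + wNil N l y) * (1 + wNil N l x))
    have hzn : ∀ i, z * wNil N l i = 0 := by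
      intro i
      ext a b
      rw [Matrix.mul_apply]
      refine Finset.sum_eq_zero fun c _ => ?_
      by_cases hc : c = Fin.last N
      · subst hc
        have : b.val ≠ N + 1 := by omega
        simp [wNil, this]
      · rw [hz, Matrix.single_apply_of_ne, zero_mul]
        rintro ⟨_, h⟩
        exact hc h.symm
    have hc : wNil N l x * wNil N l y = z + wNil N l y * wNil N l x := by
      ext a b
      rw [Matrix.add_apply, wNil_mul, wNil_mul]
      by_cases hab : b.val = a.val + 2
      · rw [if_pos hab, if_pos hab]
        by_cases ha : a.val + 2 < N
        · rw [h _ ha, hz, Matrix.single_apply_of_ne, zero_add]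
          rintro ⟨rfl, rfl⟩
          simp [wIdx_val] at ha
          omega
        · have ea : a = wIdx N := Fin.ext (by rw [wIdx_val]; omega)
          have eb : b = Fin.last N := Fin.ext (by simp; omega)
          subst ea eb
          rw [hz, Matrix.single_apply_same, hd]
          have : N - 2 + 1 = N - 1 := by omega
          simp [this, wIdx_val]
      · rw [if_neg hab, if_neg hab, hz, Matrix.single_apply_of_ne, zero_add]
        rintro ⟨rfl, rfl⟩
        simp [wIdx_val] at hab
        omega
    have e1 : (1 + z) * ((1 + wNil N l y) * (1 + wNil N l x)) =
      1 + wNil N l x + wNil N l y + (z + wNil N l y * wNil N l x)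
        + z * wNil N l x + z * wNil N l y + z * wNil N l y * wNil N l x := by noncomm_ring
    have e2 : (1 + wNil N l x) * (1 + wNil N l y) =
      1 + wNil N l x + wNil N l y + wNil N l x * wNil N l y := by noncomm_ring
    rw [e1, e2, hc, hzn, hzn]
    simp

lemma surfReal_word {g r k : ℕ} (hr : r.Prime) (hN : 3 ≤ r ^ k)
    (l : ℕ → Fin g × Bool → ZMod r)
    (h1 : ∀ c p, p + 2 < r ^ k →
      l p (c, false) * l (p + 1) (c, true) = l p (c, true) * l (p + 1) (c, false))
    (h2 : ∑ c, (l (r ^ k - 2) (c, false) * l (r ^ k - 1) (c, true)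
      - l (r ^ k - 2) (c, true) * l (r ^ k - 1) (c, false)) = 0) :
    SurfReal g r (r ^ k) (fun v => ∏ p ∈ Finset.range (r ^ k), wform l v p) := by
  have := Fact.mk hr
  let _ := wGroup (k := k) hr l
  have hfin : Finite (Multiplicative (Fin g × Bool → ZMod r)) :=
    inferInstanceAs (Finite (Fin g × Bool → ZMod r))
  let D : Submonoid (wMonoid (r ^ k) l) :=
    { carrier := {t | MFilt (r ^ k) (t.1.2 - 1)}
      one_mem' := by
        intro a b _
        simp
      mul_mem' := by
        intro s t hs ht a b hab
        have e : (s * t).1.2 - 1 = (s.1.2 - 1) + (t.1.2 - 1) + (s.1.2 - 1) * (t.1.2 - 1) := by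
          show s.1.2 * t.1.2 - 1 = _
          noncomm_ring
        rw [e, Matrix.add_apply, Matrix.add_apply, hs a b hab, ht a b hab,
          (MFilt.mul hs ht) a b (by omega)]
        simp }
  let C : Subgroup (wMonoid (r ^ k) l) :=
    { D with
      inv_mem' := fun {t} ht => D.pow_mem ht _ }
  have hmem : ∀ t, t ∈ C ↔ MFilt (r ^ k) (t.1.2 - 1) := fun t => Iff.rfl
  let Ψ : C →* Multiplicative (ZMod r) :=
    { toFun := fun t => Multiplicative.ofAdd ((t.1.1.2 - 1) 0 (Fin.last _))
      map_one' := by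
        show Multiplicative.ofAdd (((1 : Matrix (Fin (r^k+1)) (Fin (r^k+1)) (ZMod r)) - 1) 0 (Fin.last _)) = 1
        simp
      map_mul' := by
        intro s t
        have e : (s * t).1.1.2 - 1 =
            (s.1.1.2 - 1) + (t.1.1.2 - 1) + (s.1.1.2 - 1) * (t.1.1.2 - 1) := by
          show s.1.1.2 * t.1.1.2 - 1 = _
          noncomm_ring
        rw [e, (MFilt.mul s.2 t.2).eq_zero (by omega), add_zero, Matrix.add_apply, ofAdd_add] }
  have hrel : ∀ w ∈ ({surfaceRelator g} : Set (FreeGroup (Fin g × Bool))),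
      FreeGroup.lift (wGen (r ^ k) l) w = 1 := by
    intro w hw
    rw [Set.mem_singleton_iff] at hw
    subst hw
    exact ofFn_comm_prod (wZ (r ^ k) hN l) (wGen (r ^ k) l) _
      (fun c => wGen_comm (r ^ k) hN l (c, false) (c, true) (h1 c)) h2
  refine ⟨wMonoid (r ^ k) l, inferInstance, inferInstance, ?_, C,
    PresentedGroup.toGroup hrel,
    (MonoidHom.fst _ _).comp (wMonoid (r ^ k) l).subtype, Ψ, ?_, ?_, ?_⟩
  · intro t
    exact ⟨k + 1, wMonoid_tors hr l t⟩
  · intro t ht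
    rw [Subgroup.mem_center_iff]
    intro s
    apply Subtype.ext
    apply Prod.ext
    · exact mul_comm _ _
    · show s.1.2 * t.1.2 = t.1.2 * s.1.2
      have a1 : (s.1.2 - 1) * (t.1.2 - 1) = 0 := (MFilt.mul s.2.1 ht).eq_zero (by omega)
      have a2 : (t.1.2 - 1) * (s.1.2 - 1) = 0 := (MFilt.mul ht s.2.1).eq_zero (by omega)
      have e : s.1.2 * t.1.2 - t.1.2 * s.1.2 =
        (s.1.2 - 1) * (t.1.2 - 1) - (t.1.2 - 1) * (s.1.2 - 1) := by noncomm_ring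
      rw [a1, a2, sub_zero] at e
      exact sub_eq_zero.1 e
  · apply PresentedGroup.ext
    intro i
    have e1 : PresentedGroup.toGroup hrel (PresentedGroup.of i) = wGen (r ^ k) l i :=
      PresentedGroup.toGroup.of hrel
    have e2 : surfaceModAb g r (PresentedGroup.of i : PresentedGroup {surfaceRelator g}) =
        Multiplicative.ofAdd (Pi.single i (1 : ZMod r)) := PresentedGroup.toGroup.of _
    exact Eq.trans (congrArg (fun t : wMonoid (r ^ k) l => t.1.1) e1) e2.symm
  · intro t
    have e : (t ^ (r ^ k)).1.2 - 1 = (t.1.2 - 1) ^ (r ^ k) := by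
      show t.1.2 ^ (r ^ k) - 1 = _
      rw [wMonoid_pow hr, add_sub_cancel_left]
    have hm : t ^ (r ^ k) ∈ C := by
      rw [hmem, e]
      exact t.2.1.pow _
    refine ⟨hm, ?_⟩
    show Multiplicative.ofAdd (((t ^ (r ^ k)).1.2 - 1) 0 (Fin.last _)) = _
    rw [e, MFilt.pow_apply t.2.1 _ t.2.2 (r ^ k) 0 (Fin.last _) (by simp)]
    simp

lemma SurfReal.congr {g r N : ℕ} {f f' : (Fin g × Bool → ZMod r) → ZMod r}
    (hf : SurfReal g r N f) (h : ∀ v, f v = f' v) : SurfReal g r N f' := by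
  rwa [← funext h]

lemma surfReal_list {g r k : ℕ} (hr : r.Prime) (hN : 3 ≤ r ^ k) (w : List (Fin g × Bool))
    (hw : w.length = r ^ k)
    (hch : w.IsChain (fun a b => a.1 = b.1 → a.2 = b.2)) :
    SurfReal g r (r ^ k) (fun v => (w.map v).prod) := by
  let l : ℕ → Fin g × Bool → ZMod r := fun p i => if w[p]? = some i then 1 else 0
  have key : ∀ p, p + 1 < r ^ k → ∀ c s t, s ≠ t → l p (c, s) * l (p + 1) (c, t) = 0 := by
    intro p hp c s t hst
    have h3 := List.isChain_iff_getElem.1 hch p (by omega)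
    simp only [l]
    rw [List.getElem?_eq_getElem (by omega), List.getElem?_eq_getElem (by omega)]
    simp only [Option.some.injEq]
    split_ifs with h4 h5
    · rw [h4, h5] at h3
      exact absurd (h3 rfl) hst
    · simp
    · simp
    · simp
  refine (surfReal_word hr hN l ?_ ?_).congr ?_
  · intro c p hp
    rw [key p (by omega) c _ _ (by simp), key p (by omega) c _ _ (by simp)]
  · refine Finset.sum_eq_zero fun c _ => ?_
    have e : r ^ k - 1 = r ^ k - 2 + 1 := by omega
    rw [e, key _ (by omega) c _ _ (by simp), key _ (by omega) c _ _ (by simp), sub_zero]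
  · intro v
    have e : ∀ p (hp : p < w.length), wform l v p = v w[p] := by
      intro p hp
      simp only [wform, l]
      rw [List.getElem?_eq_getElem hp]
      simp
    rw [← hw, Finset.prod_range]
    rw [Finset.prod_congr rfl (fun (p : Fin w.length) _ => e p.1 p.2)]
    rw [← List.prod_ofFn]
    congr 1
    apply List.ext_getElem <;> simp

lemma surfReal_mon {g r k : ℕ} (hr : r.Prime) (hN : 3 ≤ r ^ k) (M : Multiset (Fin g × Bool))
    (hM : M.card = r ^ k)
    (hgood : (∃ s, ∀ i ∈ M, i.2 = s) ∨ ∃ a b, a ≠ b ∧ (a, false) ∈ M ∧ (b, true) ∈ M) :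
    SurfReal g r (r ^ k) (fun v => (M.map v).prod) := by
  classical
  have hpair : ∀ (s : Bool) (L : List (Fin g × Bool)), (∀ i ∈ L, i.2 = s) →
      L.IsChain (fun a b => a.1 = b.1 → a.2 = b.2) := by
    intro s L hL
    rw [List.isChain_iff_getElem]
    intro p hp _
    rw [hL _ (List.getElem_mem _), hL _ (List.getElem_mem _)]
  rcases hgood with ⟨s, hs⟩ | ⟨a, b, hab, ha, hb⟩
  · refine (surfReal_list hr hN M.toList (by simpa using hM)
      (hpair s _ (fun i hi => hs i (by simpa using hi)))).congr fun v => ?_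
    conv_rhs => rw [← Multiset.coe_toList M]
    rw [Multiset.map_coe, Multiset.prod_coe]
  · have ha' : (a, false) ∈ M.filter (fun i => i.2 = false) := by simp [ha]
    have hb' : (b, true) ∈ M.filter (fun i => ¬ i.2 = false) := by simp [hb]
    obtain ⟨M1, h1⟩ := Multiset.exists_cons_of_mem ha'
    obtain ⟨M2, h2⟩ := Multiset.exists_cons_of_mem hb'
    have hsum := Multiset.filter_add_not (fun i : Fin g × Bool => i.2 = false) M
    let w : List (Fin g × Bool) := (M1.toList ++ [(a, false)]) ++ ((b, true) :: M2.toList)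
    have hw : (w : Multiset (Fin g × Bool)) = M := by
      rw [← hsum, h1, h2]
      simp only [w]
      rw [← Multiset.coe_add, ← Multiset.coe_add, ← Multiset.cons_coe (b, true),
        Multiset.coe_toList, Multiset.coe_toList, add_comm M1, Multiset.coe_singleton,
        Multiset.singleton_add]
    refine (surfReal_list hr hN w ?_ ?_).congr fun v => ?_
    · rw [← hM, ← hw, Multiset.coe_card]
    · rw [List.isChain_append]
      refine ⟨hpair false _ ?_, hpair true _ ?_, ?_⟩
      · intro i hi
        have : i ∈ (a, false) ::ₘ M1 := by
          simp only [List.mem_append, Multiset.mem_toList, List.mem_singleton] at hi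
          rw [Multiset.mem_cons]
          exact hi.symm
        rw [← h1] at this
        exact (Multiset.mem_filter.1 this).2
      · intro i hi
        have : i ∈ (b, true) ::ₘ M2 := by
          simp only [List.mem_cons, Multiset.mem_toList] at hi
          rw [Multiset.mem_cons]
          exact hi
        rw [← h2] at this
        simpa using (Multiset.mem_filter.1 this).2
      · intro x hx y hy hxy
        simp at hx hy
        subst hx hy
        exact absurd hxy hab
    · rw [← hw, Multiset.map_coe, Multiset.prod_coe]

lemma surfReal_exc {g r k : ℕ} (hr : r.Prime) (hN : 3 ≤ r ^ k) (a b : Fin g) (hab : a ≠ b)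
    (s : Bool) :
    SurfReal g r (r ^ k) (fun v => v (a, s) ^ (r ^ k - 1) * v (a, !s)) := by
  let l : ℕ → Fin g × Bool → ZMod r := fun p i =>
    if p + 2 < r ^ k then (if i = (a, s) then 1 else 0)
    else if p + 2 = r ^ k then (if i = (a, s) then 1 else 0) + (if i = (b, s) then 1 else 0)
    else (if i = (a, !s) then 1 else 0) - (if i = (b, !s) then 1 else 0)
  have l1 : ∀ p, p + 2 < r ^ k → ∀ i, l p i = if i = (a, s) then 1 else 0 := by
    intro p hp i
    simp only [l, if_pos hp]
  have l2 : ∀ i, l (r ^ k - 2) i =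
      (if i = (a, s) then 1 else 0) + (if i = (b, s) then 1 else 0) := by
    intro i
    have e1 : ¬ (r ^ k - 2 + 2 < r ^ k) := by omega
    have e2 : r ^ k - 2 + 2 = r ^ k := by omega
    simp only [l, if_neg e1, if_pos e2]
  have l3 : ∀ i, l (r ^ k - 1) i =
      (if i = (a, !s) then 1 else 0) - (if i = (b, !s) then 1 else 0) := by
    intro i
    have e1 : ¬ (r ^ k - 1 + 2 < r ^ k) := by omega
    have e2 : ¬ (r ^ k - 1 + 2 = r ^ k) := by omega
    simp only [l, if_neg e1, if_neg e2]
  have hz : ∀ p, p + 1 < r ^ k → ∀ c, l p (c, !s) = 0 := by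
    intro p hp c
    by_cases h : p + 2 < r ^ k
    · rw [l1 p h]; simp
    · have : p = r ^ k - 2 := by omega
      subst this
      rw [l2]; simp
  have hword := surfReal_word hr hN l (by
      intro c p hp
      have z1 := hz p (by omega) c
      have z2 := hz (p + 1) (by omega) c
      cases s <;> simp only [Bool.not_true, Bool.not_false] at z1 z2 <;> rw [z1, z2] <;> simp) (by
      simp only [l2, l3]
      cases s <;>
        simp [add_mul, mul_sub, Finset.sum_add_distrib, Finset.sum_sub_distrib, hab, hab.symm])
  have hword' : SurfReal g r (r ^ k) (fun v => v (a, s) ^ (r ^ k - 2) * (v (a, s) + v (b, s)) *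
      (v (a, !s) - v (b, !s))) := by
    refine hword.congr fun v => ?_
    have e : r ^ k = r ^ k - 2 + 1 + 1 := by omega
    have e' : r ^ k - 1 = r ^ k - 2 + 1 := by omega
    conv_lhs => rw [e]
    rw [Finset.prod_range_succ, Finset.prod_range_succ, ← e']
    have w1 : ∀ p ∈ Finset.range (r ^ k - 2), wform l v p = v (a, s) := by
      intro p hp
      rw [Finset.mem_range] at hp
      simp [wform, l1 p (by omega)]
    rw [Finset.prod_congr rfl w1]
    simp [wform, l2, l3, add_mul, sub_mul, Finset.sum_add_distrib]
  have mon : ∀ (m : ℕ) (M : Multiset (Fin g × Bool)), M.card + m = r ^ k → 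
      0 < m → (b, !s) ∈ M ∨ ((a, !s) ∈ M ∧ (b, s) ∈ M) →
      SurfReal g r (r ^ k) (fun v => v (a, s) ^ m * (M.map v).prod) := by
    intro m M hM hm hin
    have hmem : (a, s) ∈ Multiset.replicate m (a, s) := Multiset.mem_replicate.2 ⟨by omega, rfl⟩
    refine (surfReal_mon hr hN (Multiset.replicate m (a, s) + M) ?_ (Or.inr ?_)).congr fun v => ?_
    · rw [Multiset.card_add, Multiset.card_replicate, add_comm]; exact hM
    · rcases hin with h | ⟨h, h'⟩
      · cases s
        · exact ⟨a, b, hab, Multiset.mem_add.2 (Or.inl hmem), Multiset.mem_add.2 (Or.inr h)⟩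
        · exact ⟨b, a, hab.symm, Multiset.mem_add.2 (Or.inr h), Multiset.mem_add.2 (Or.inl hmem)⟩
      · cases s
        · exact ⟨b, a, hab.symm, Multiset.mem_add.2 (Or.inr h'), Multiset.mem_add.2 (Or.inr h)⟩
        · exact ⟨a, b, hab, Multiset.mem_add.2 (Or.inr h), Multiset.mem_add.2 (Or.inr h')⟩
    · simp
  have m1 := mon (r ^ k - 1) {(b, !s)} (by simp; omega) (by omega) (by simp)
  have m2 := mon (r ^ k - 2) {(b, s), (a, !s)} (by simp; omega) (by omega) (by simp)
  have m3 := mon (r ^ k - 2) {(b, s), (b, !s)} (by simp; omega) (by omega) (by simp)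
  refine (((hword'.add m1).add (m2.smul (-1))).add m3).congr fun v => ?_
  have e' : r ^ k - 1 = r ^ k - 2 + 1 := by omega
  simp [e', pow_succ]
  ring

lemma pow_mul_pred {r : ℕ} [Fact r.Prime] (x : ZMod r) (m : ℕ) (hm : 0 < m) :
    x ^ (m * (r - 1)) = x ^ (r - 1) := by
  have h2 := (Fact.out : r.Prime).two_le
  by_cases hx : x = 0
  · subst hx
    rw [zero_pow, zero_pow]
    · omega
    · exact Nat.mul_ne_zero (by omega) (by omega)
  · rw [mul_comm, pow_mul, ZMod.pow_card_sub_one_eq_one hx, one_pow]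

lemma surfReal_h {g r k : ℕ} (hg : 2 ≤ g) (hr : r.Prime) (hN : 3 ≤ r ^ k)
    (hbig : (2 * g - 1) * (r - 1) < r ^ k) (T : Finset (Fin g × Bool)) (i : Fin g × Bool)
    (hi : i ∉ T) :
    SurfReal g r (r ^ k) (fun v => (∏ j ∈ T, v j) ^ (r - 1) * v i) := by
  classical
  have := Fact.mk hr
  have h2 := hr.two_le
  obtain ⟨m, hm⟩ : (r - 1) ∣ r ^ k - 1 := by simpa using Nat.sub_dvd_pow_sub_pow r 1 k
  have hT : T.card ≤ 2 * g - 1 := by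
    have h3 : (insert i T).card ≤ Fintype.card (Fin g × Bool) := Finset.card_le_univ _
    rw [Finset.card_insert_of_notMem hi] at h3
    simp at h3
    omega
  have hTm : T.card ≤ m := by
    have : (2 * g - 1) * (r - 1) ≤ m * (r - 1) := by
      rw [mul_comm m]; omega
    exact hT.trans (Nat.le_of_mul_le_mul_right this (by omega))
  have hm0 : 0 < m := by
    rcases Nat.eq_zero_or_pos m with h | h
    · subst h; omega
    · exact h
  obtain ⟨n, rfl⟩ := Nat.exists_eq_add_of_le hTm
  let M : Multiset (Fin g × Bool) := (r - 1) • T.val + Multiset.replicate (n * (r - 1) + 1) i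
  have hMcard : M.card = r ^ k := by
    simp only [M, Multiset.card_add, Multiset.card_nsmul, Multiset.card_replicate, Finset.card_val,
      smul_eq_mul]
    have : (r - 1) * (T.card + n) = (r - 1) * T.card + n * (r - 1) := by ring
    omega
  have hmem : ∀ j, j ∈ M ↔ j ∈ T ∨ j = i := by
    intro j
    simp only [M, Multiset.mem_add, Multiset.mem_replicate]
    rw [Multiset.mem_nsmul_of_ne_zero (by omega), Finset.mem_val]
    simp
  by_cases hgood : (∃ s, ∀ i ∈ M, i.2 = s) ∨ ∃ a b, a ≠ b ∧ (a, false) ∈ M ∧ (b, true) ∈ M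
  · refine (surfReal_mon hr hN M hMcard hgood).congr fun v => ?_
    simp only [M, Multiset.map_add, Multiset.prod_add, Multiset.map_nsmul, Multiset.prod_nsmul,
      Multiset.map_replicate, Multiset.prod_replicate]
    congr 1
    rcases Nat.eq_zero_or_pos n with h | h
    · subst h; simp
    · rw [pow_succ, pow_mul_pred _ _ h, ← pow_succ, Nat.sub_add_cancel (by omega), ZMod.pow_card]
  · push Not at hgood
    obtain ⟨hg1, hg2⟩ := hgood
    obtain ⟨⟨b, tb⟩, hb, hb'⟩ := hg1 false
    obtain ⟨⟨a, ta⟩, ha, ha'⟩ := hg1 true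
    have etb : tb = true := by simpa using hb'
    have eta : ta = false := by simpa using ha'
    subst etb eta
    have hba : b = a := by
      by_contra h
      exact hg2 a b (Ne.symm h) ha hb
    subst hba
    have hall : ∀ j ∈ M, j.1 = b := by
      rintro ⟨c, t⟩ hc
      by_contra h
      cases t
      · exact hg2 c b h hc hb
      · exact hg2 b c (Ne.symm h) ha hc
    have hib : i.1 = b := hall i ((hmem i).2 (Or.inr rfl))
    obtain ⟨c, s⟩ := i
    dsimp only at hib
    subst hib
    have hTe : T = {(c, !s)} := by
      ext ⟨j, t⟩
      rw [Finset.mem_singleton]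
      constructor
      · intro hj
        have e := hall _ ((hmem _).2 (Or.inl hj))
        dsimp only at e
        subst e
        rcases Bool.eq_or_eq_not t s with rfl | rfl
        · exact absurd hj hi
        · rfl
      · intro hj
        rw [hj]
        have : (c, !s) ∈ M := by cases s <;> assumption
        rcases (hmem _).1 this with h | h
        · exact h
        · simp at h
    have : Nontrivial (Fin g) := Fin.nontrivial_iff_two_le.2 hg
    obtain ⟨d, hd⟩ := exists_ne c
    refine (surfReal_exc hr hN c d hd.symm (!s)).congr fun v => ?_
    rw [hTe, hm, mul_comm (r - 1), pow_mul_pred _ _ hm0]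
    simp

lemma surfReal_zero {g r k : ℕ} (hg : 2 ≤ g) (hr : r.Prime) (hN : 3 ≤ r ^ k)
    (hbig : (2 * g - 1) * (r - 1) < r ^ k) : SurfReal g r (r ^ k) (fun _ => 0) :=
  ((surfReal_h hg hr hN hbig ∅ (⟨0, by omega⟩, false) (by simp)).smul 0).congr (by simp)

lemma surfReal_exists {g r k : ℕ} (hg : 2 ≤ g) (hr : r.Prime) (hN : 3 ≤ r ^ k)
    (hbig : (2 * g - 1) * (r - 1) < r ^ k) (A : Finset (Fin g × Bool)) :
    ∃ F : (Fin g × Bool → ZMod r) → ZMod r,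
      (∀ T, Disjoint T A → SurfReal g r (r ^ k) (fun v => (∏ j ∈ T, v j) ^ (r - 1) * F v)) ∧
      ∀ v, (∃ i ∈ A, v i ≠ 0) → F v ≠ 0 := by
  classical
  have := Fact.mk hr
  have h2 := hr.two_le
  induction A using Finset.induction_on with
  | empty =>
    refine ⟨fun _ => 0, fun T _ => (surfReal_zero hg hr hN hbig).congr (by simp), ?_⟩
    rintro v ⟨i, hi, _⟩
    simp at hi
  | insert a A ha ih =>
    obtain ⟨F, hF1, hF2⟩ := ih
    refine ⟨fun v => v a + (1 - v a ^ (r - 1)) * F v, fun T hT => ?_, fun v hv => ?_⟩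
    · rw [Finset.disjoint_insert_right] at hT
      have t1 := surfReal_h hg hr hN hbig T a hT.1
      have t2 := hF1 T hT.2
      have t3 := hF1 (insert a T) (by rw [Finset.disjoint_insert_left]; exact ⟨ha, hT.2⟩)
      refine ((t1.add t2).add (t3.smul (-1))).congr fun v => ?_
      rw [Finset.prod_insert hT.1, mul_pow]
      ring
    · by_cases h : v a = 0
      · have : F v ≠ 0 := by
          apply hF2
          obtain ⟨i, hi, hi'⟩ := hv
          rcases Finset.mem_insert.1 hi with rfl | hi
          · exact absurd h hi'
          · exact ⟨i, hi, hi'⟩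
        have hne : r - 1 ≠ 0 := by omega
        simpa [h, zero_pow hne] using this
      · simpa [ZMod.pow_card_sub_one_eq_one h] using h

/-- Proposition 9b: the special r-group quotient of the surface group π₁Σ_g. -/
theorem special_pgroup_surface (g : ℕ) (hg : 2 ≤ g) (r : ℕ) (hr : r.Prime) (hodd : Odd r)
    (k : ℕ) (hk : 0 < k) (hbig : (2 * g - 1) * (r - 1) < r ^ k) :
    ∃ (G : Type) (_ : Group G) (_ : Fintype G),
      (∃ j : ℕ, Fintype.card G = r ^ j) ∧
      ∃ (C : Subgroup G) (ρ : SurfaceGroup g →* G)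
        (α : G →* Multiplicative (Fin g × Bool → ZMod r))
        (Ψ : ↥C →* Multiplicative (ZMod r)),
        C ≤ Subgroup.center G ∧
        α.comp ρ = surfaceModAb g r ∧
        ∀ x : G, α x ≠ 1 → ∃ h : x ^ r ^ k ∈ C, Ψ ⟨x ^ r ^ k, h⟩ ≠ 1 := by
  have h2 := hr.two_le
  have := Fact.mk hr
  have h3 : 3 ≤ r := by
    obtain ⟨m, hm⟩ := hodd
    omega
  have hN : 3 ≤ r ^ k := h3.trans (Nat.le_self_pow (by omega) r)
  obtain ⟨F, hF1, hF2⟩ := surfReal_exists hg hr hN hbig Finset.univ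
  have hF := (hF1 ∅ (by simp)).congr (f' := F) (by simp)
  obtain ⟨G, i1, i2, hp, C, ρ, α, Ψ, hC, hα, h⟩ := hF
  have i3 : Fintype G := Fintype.ofFinite G
  refine ⟨G, i1, i3, ?_, C, ρ, α, Ψ, hC, hα, fun x hx => ?_⟩
  · obtain ⟨j, hj⟩ := IsPGroup.iff_card.1 hp
    exact ⟨j, by rw [← Nat.card_eq_fintype_card]; exact hj⟩
  · obtain ⟨h4, h5⟩ := h x
    refine ⟨h4, ?_⟩
    rw [h5]
    intro h6
    apply hF2 (Multiplicative.toAdd (α x))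
    · by_contra h7
      push Not at h7
      apply hx
      apply Multiplicative.toAdd.injective
      funext i
      exact h7 i (Finset.mem_univ i)
    · exact Multiplicative.ofAdd.injective h6
end

section
/- Let n ≥ 1, let r be a prime, and let k be a positive integer with r^k > (n−1)(r−1). Then there exists a multivariate polynomial P in n variables over the field 𝔽_r = ℤ/r which is homogeneous of degree r^k and such that P(a) ≠ 0 for every nonzero vector a ∈ (ℤ/r)^n. -/
/-- Lemma 11: for r^k > (n−1)(r−1) there is a homogeneous polynomial of degree r^k over
𝔽_r in n variables that is nonvanishing on (ℤ/r)^n ∖ {0}. -/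
theorem nonvanishing_polynomial (n : ℕ) (hn : 1 ≤ n) (r : ℕ) (hr : r.Prime)
    (k : ℕ) (hk : 0 < k) (hbig : (n - 1) * (r - 1) < r ^ k) :
    ∃ P : MvPolynomial (Fin n) (ZMod r),
      P.IsHomogeneous (r ^ k) ∧
      ∀ a : Fin n → ZMod r, a ≠ 0 → MvPolynomial.eval a P ≠ 0 := by
  haveI : Fact r.Prime := ⟨hr⟩
  have hr2 := hr.two_le
  have hcard : ∀ i : Fin n, ∀ S ∈ (Finset.Iio i).powerset, S.card * (r - 1) < r ^ k := by
    intro i S hS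
    have h1 := Finset.card_le_card (Finset.mem_powerset.1 hS)
    rw [Fin.card_Iio] at h1
    have h2 : S.card ≤ n - 1 := by have := i.2; omega
    exact lt_of_le_of_lt (Nat.mul_le_mul_right _ h2) hbig
  refine ⟨∑ i : Fin n, ∑ S ∈ (Finset.Iio i).powerset,
    MvPolynomial.X i ^ (r ^ k - S.card * (r - 1)) *
      ∏ j ∈ S, (-(MvPolynomial.X j ^ (r - 1))), ?_, ?_⟩
  · refine MvPolynomial.IsHomogeneous.sum _ _ _ fun i _ =>
      MvPolynomial.IsHomogeneous.sum _ _ _ fun S hS => ?_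
    have h1 := MvPolynomial.isHomogeneous_X_pow (R := ZMod r) i (r ^ k - S.card * (r - 1))
    have h2 := MvPolynomial.IsHomogeneous.prod S
      (fun j : Fin n => (-(MvPolynomial.X j ^ (r - 1)) : MvPolynomial (Fin n) (ZMod r)))
      (fun _ => r - 1) (fun j _ => (MvPolynomial.isHomogeneous_X_pow j (r - 1)).neg)
    have h3 := h1.mul h2
    rw [Finset.sum_const, smul_eq_mul, Nat.sub_add_cancel (hcard i S hS).le] at h3
    exact h3
  · intro a ha
    have hpow : ∀ i : Fin n, ∀ S ∈ (Finset.Iio i).powerset,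
        a i ^ (r ^ k - S.card * (r - 1)) = a i := by
      intro i S hS
      have h := hcard i S hS
      by_cases h0 : a i = 0
      · rw [h0, zero_pow (by omega)]
      · have h1 : a i ^ (S.card * (r - 1)) = 1 := by
          rw [mul_comm, pow_mul, ZMod.pow_card_sub_one_eq_one h0, one_pow]
        have h2 : a i ^ (r ^ k - S.card * (r - 1)) * a i ^ (S.card * (r - 1)) = a i := by
          rw [← pow_add, Nat.sub_add_cancel h.le, ZMod.pow_card_pow]
        rwa [h1, mul_one] at h2
    have hev : ∀ i : Fin n, ∑ S ∈ (Finset.Iio i).powerset,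
        a i ^ (r ^ k - S.card * (r - 1)) * ∏ j ∈ S, (-(a j ^ (r - 1)))
        = a i * ∏ j ∈ Finset.Iio i, (1 + -(a j ^ (r - 1))) := by
      intro i
      rw [Finset.prod_one_add, Finset.mul_sum]
      exact Finset.sum_congr rfl fun S hS => by rw [hpow i S hS]
    simp only [map_sum, map_mul, map_pow, map_prod, map_neg, MvPolynomial.eval_X, hev]
    obtain ⟨i, hi, hmin⟩ : ∃ i, a i ≠ 0 ∧ ∀ j < i, a j = 0 := by
      obtain ⟨i0, hi0⟩ := Function.ne_iff.1 ha
      obtain ⟨i, hi, hm⟩ := WellFounded.has_min (wellFounded_lt (α := Fin n))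
        {i | a i ≠ 0} ⟨i0, hi0⟩
      exact ⟨i, hi, fun j hj => by_contra fun h => hm j h hj⟩
    rw [Finset.sum_eq_single i]
    · rw [Finset.prod_eq_one, mul_one]
      · exact hi
      · intro j hj
        rw [hmin j (Finset.mem_Iio.1 hj), zero_pow (by omega), neg_zero, add_zero]
    · intro l _ hl
      rcases lt_or_gt_of_ne hl with h | h
      · rw [hmin l h, zero_mul]
      · rw [Finset.prod_eq_zero (Finset.mem_Iio.2 h), mul_zero]
        rw [ZMod.pow_card_sub_one_eq_one hi, add_neg_cancel]
    · simp
end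

section
/- Let n ≥ 2, let r be a prime, and let k be a positive integer with r^k > (n−1)(r−1). Then there exists a multivariate polynomial P in the variables a₁, …, a_n over 𝔽_r = ℤ/r which is homogeneous of degree r^k, satisfies P(a) ≠ 0 for every nonzero a ∈ (ℤ/r)^n, and such that every monomial of P with nonzero coefficient is of one of the following three types: (I) a power a_j^v of a single variable with v ≡ 1 (mod r−1); (II) a product involving at least three distinct variables with positive exponent; (III) a product a_j^v · a_{j'}^{v'} of powers of exactly two distinct variables with v ≡ 1 (mod r−1) and v' ≡ 0 (mod r−1). -/
/-- The exponent vector of `a_j^e * ∏_{i ∈ S} a_i^q`. -/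
noncomputable def monExp {n : ℕ} (j : Fin n) (S : Finset (Fin n)) (e q : ℕ) : Fin n →₀ ℕ :=
  Finsupp.single j e + ∑ i ∈ S, Finsupp.single i q

lemma monExp_apply {n : ℕ} (j : Fin n) (S : Finset (Fin n)) (hj : j ∉ S) (e q : ℕ) (i : Fin n) :
    monExp j S e q i = if i = j then e else if i ∈ S then q else 0 := by
  classical
  unfold monExp
  simp only [Finsupp.add_apply, Finsupp.finsetSum_apply, Finsupp.single_apply]
  by_cases h : i = j
  · subst h; simp [hj]
  · simp [h, Ne.symm h]

lemma monExp_support {n : ℕ} (j : Fin n) (S : Finset (Fin n)) (hj : j ∉ S) (e q : ℕ)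
    (he : 0 < e) (hq : 0 < q) : (monExp j S e q).support = insert j S := by
  ext i
  rw [Finsupp.mem_support_iff, monExp_apply j S hj]
  by_cases h : i = j
  · simp [h, he.ne']
  · simp [h, hq.ne']

lemma monExp_degree {n : ℕ} (j : Fin n) (S : Finset (Fin n)) (e q : ℕ) :
    (monExp j S e q).degree = e + S.card * q := by
  simp [monExp, Finsupp.degree_single]

lemma monExp_eval {n r : ℕ} (j : Fin n) (S : Finset (Fin n)) (e q : ℕ) (x : ZMod r)
    (a : Fin n → ZMod r) : MvPolynomial.eval a (MvPolynomial.monomial (monExp j S e q) x)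
      = x * (a j ^ e * ∏ i ∈ S, a i ^ q) := by
  classical
  rw [MvPolynomial.eval_monomial]
  unfold monExp
  rw [Finsupp.prod_add_index' (by simp) (by intros; rw [pow_add]),
    Finsupp.prod_single_index (by simp),
    ← Finsupp.prod_finsetSum_index (by simp) (by intros; rw [pow_add])]
  simp


/-- Lemma 11 + Observation 15: for n ≥ 2 and r^k > (n−1)(r−1) there is a homogeneous
polynomial of degree r^k over 𝔽_r in n variables, nonvanishing on (ℤ/r)^n ∖ {0}, all of
whose monomials are of type I (a power a_j^v of a single variable with v ≡ 1 mod r−1),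
type II (involving at least three distinct variables), or type III (a_j^v · a_{j'}^{v'}
with exactly two distinct variables, v ≡ 1 and v' ≡ 0 mod r−1). -/
theorem nonvanishing_polynomial_monomial_types (n : ℕ) (hn : 2 ≤ n)
    (r : ℕ) (hr : r.Prime) (k : ℕ) (hk : 0 < k) (hbig : (n - 1) * (r - 1) < r ^ k) :
    ∃ P : MvPolynomial (Fin n) (ZMod r),
      P.IsHomogeneous (r ^ k) ∧
      (∀ a : Fin n → ZMod r, a ≠ 0 → MvPolynomial.eval a P ≠ 0) ∧
      ∀ c ∈ P.support,
        (∃ j : Fin n, c.support = {j} ∧ c j ≡ 1 [MOD r - 1]) ∨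
        (3 ≤ c.support.card) ∨
        (∃ j j' : Fin n, j ≠ j' ∧ c.support = {j, j'} ∧
          c j ≡ 1 [MOD r - 1] ∧ c j' ≡ 0 [MOD r - 1]) := by
  classical
  have := Fact.mk hr
  have hr2 := hr.two_le
  obtain ⟨t, ht⟩ : ∃ t, r ^ k = 1 + (r - 1) * t := by
    obtain ⟨t, ht⟩ := Nat.sub_dvd_pow_sub_pow r 1 k
    rw [one_pow] at ht
    have : 0 < r ^ k := by positivity
    exact ⟨t, by omega⟩
  have hnt : n - 1 ≤ t := by
    rw [ht] at hbig
    have h1 : (r - 1) * (n - 1) ≤ (r - 1) * t := by rw [mul_comm (r - 1) (n - 1)]; omega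
    exact Nat.le_of_mul_le_mul_left h1 (by omega)
  have hcard : ∀ (j : Fin n) (S : Finset (Fin n)), S ⊆ Finset.Iio j → j ∉ S ∧ S.card ≤ t := by
    intro j S hS
    refine ⟨fun h => by simpa using hS h, ?_⟩
    have := Finset.card_le_card hS
    rw [Fin.card_Iio] at this
    omega
  let e : Finset (Fin n) → ℕ := fun S => 1 + (r - 1) * (t - S.card)
  let P : MvPolynomial (Fin n) (ZMod r) := ∑ j : Fin n, ∑ S ∈ (Finset.Iio j).powerset,
    MvPolynomial.monomial (monExp j S (e S) (r - 1)) ((-1) ^ S.card)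
  refine ⟨P, ?_, ?_, ?_⟩
  · refine MvPolynomial.IsHomogeneous.sum _ _ _ fun j _ =>
      MvPolynomial.IsHomogeneous.sum _ _ _ fun S hS => MvPolynomial.isHomogeneous_monomial _ ?_
    obtain ⟨_, h2⟩ := hcard j S (Finset.mem_powerset.1 hS)
    rw [monExp_degree, ht]
    obtain ⟨u, rfl⟩ := Nat.exists_eq_add_of_le h2
    simp only [e, Nat.add_sub_cancel_left]
    ring
  · intro a ha
    have hpow : ∀ (x : ZMod r) (m : ℕ), x ^ (1 + (r - 1) * m) = x := by
      intro x m
      by_cases hx : x = 0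
      · subst hx; simp
      · rw [pow_add, pow_mul, ZMod.pow_card_sub_one_eq_one hx]; simp
    have hev : MvPolynomial.eval a P = ∑ j, a j * ∏ i ∈ Finset.Iio j, (1 - a i ^ (r - 1)) := by
      simp only [P, map_sum, monExp_eval]
      refine Finset.sum_congr rfl fun j _ => ?_
      rw [Finset.prod_sub, Finset.mul_sum]
      refine Finset.sum_congr rfl fun S _ => ?_
      rw [hpow, Finset.prod_const_one]
      ring
    obtain ⟨j1, hj1⟩ := Function.ne_iff.1 ha
    obtain ⟨j0, h0, hmin⟩ := WellFounded.has_min (wellFounded_lt (α := Fin n))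
      {j | a j ≠ 0} ⟨j1, hj1⟩
    have hlt : ∀ i < j0, a i = 0 := fun i hi => by
      by_contra h
      exact hmin i h hi
    have h0' : a j0 ≠ 0 := h0
    rw [hev, Finset.sum_eq_single j0]
    · rw [Finset.prod_eq_one]
      · simpa using h0'
      · intro i hi
        rw [hlt i (Finset.mem_Iio.1 hi), zero_pow (by omega), sub_zero]
    · intro j _ hne
      rcases lt_or_gt_of_ne hne with h | h
      · rw [hlt j h, zero_mul]
      · rw [Finset.prod_eq_zero (Finset.mem_Iio.2 h), mul_zero]
        rw [ZMod.pow_card_sub_one_eq_one h0', sub_self]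
    · simp
  · intro c hc
    have hc1 := MvPolynomial.support_sum hc
    obtain ⟨j, _, hc2⟩ := Finset.mem_biUnion.1 hc1
    have hc3 := MvPolynomial.support_sum hc2
    obtain ⟨S, hS, hc4⟩ := Finset.mem_biUnion.1 hc3
    have hceq := Finset.mem_singleton.1 (MvPolynomial.support_monomial_subset hc4)
    obtain ⟨h1, h2⟩ := hcard j S (Finset.mem_powerset.1 hS)
    have hsup : c.support = insert j S := by
      rw [hceq]; exact monExp_support j S h1 _ _ (by simp only [e]; omega) (by omega)
    have hcj : c j ≡ 1 [MOD r - 1] := by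
      rw [hceq, monExp_apply j S h1, if_pos rfl]
      simp [e, Nat.ModEq]
    rcases Nat.lt_or_ge S.card 2 with hlt | hge
    · rcases Nat.eq_zero_or_pos S.card with hz | hp
      · left
        rw [Finset.card_eq_zero] at hz
        exact ⟨j, by rw [hsup, hz]; rfl, hcj⟩
      · right; right
        obtain ⟨i, rfl⟩ := Finset.card_eq_one.1 (show S.card = 1 by omega)
        have hne : j ≠ i := by simpa using h1
        refine ⟨j, i, hne, hsup, hcj, ?_⟩
        rw [hceq, monExp_apply j _ h1, if_neg hne.symm]
        simp [Nat.ModEq]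
    · right; left
      rw [hsup, Finset.card_insert_of_notMem h1]
      omega
end
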